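/- arXiv:astro-ph/0008236 — 3 statements merged into one kernel-verified Lean document; each statement's English description precedes it below -/
import Mathlib

section
/- Let M > 0, 0 ≤ a ≤ M, m ∈ ℤ, and set Δ(r) := r² − 2Mr + a², r₊ := M + √(M² − a²). Let X_r := L²((r₊,∞), (r⁴/Δ(r)) dr) and let A_{r0} be the densely defined operator in X_r with domain the C² functions of compact support in (r₊,∞), given by A_{r0}u := (Δ/r⁴)·[ −(Δ u′)′ − (m²a²/Δ) u ]. Then A_{r0} is essentially self-adjoint, i.e. its closure is self-adjoint (equivalently, the adjoint of A_{r0} equals the closure of A_{r0}). -/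
open MeasureTheory

/-- Kerr horizon function `Δ(r) = r² − 2Mr + a²`. -/
noncomputable def kerrDelta (M a r : ℝ) : ℝ := r ^ 2 - 2 * M * r + a ^ 2

/-- Outer horizon radius `r₊ = M + √(M² − a²)`. -/
noncomputable def rPlus (M a : ℝ) : ℝ := M + Real.sqrt (M ^ 2 - a ^ 2)

/-- The measure `(r⁴/Δ(r)) dr` on `(r₊,∞)`, defining the radial Hilbert space `X_r`. -/
noncomputable def radialMeasure (M a : ℝ) : Measure ℝ :=
  ((volume : Measure ℝ).withDensity
    (fun r => ENNReal.ofReal (r ^ 4 / kerrDelta M a r))).restrict (Set.Ioi (rPlus M a))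

/-- The radial Sturm–Liouville differential expression
`A_{r0} u = (Δ/r⁴)·[−(Δu′)′ − (m²a²/Δ)u]`. -/
noncomputable def radialOp (M a : ℝ) (m : ℤ) (u : ℝ → ℂ) (r : ℝ) : ℂ :=
  ((kerrDelta M a r / r ^ 4 : ℝ) : ℂ) *
    (-deriv (fun x => ((kerrDelta M a x : ℝ) : ℂ) * deriv u x) r -
      (((m : ℝ) ^ 2 * a ^ 2 / kerrDelta M a r : ℝ) : ℂ) * u r)

theorem esa_of_lower_bound {E : Type*} [NormedAddCommGroup E] [InnerProductSpace ℂ E]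
    [CompleteSpace E] (T : E →ₗ.[ℂ] E) (hd : Dense (T.domain : Set E))
    (hs : T.IsFormalAdjoint T) (l : ℝ)
    (hb : ∀ x : T.domain, ‖(x : E)‖ ≤ ‖T x + (l : ℂ) • (x : E)‖)
    (hk : ∀ y : E, (∀ x : T.domain, inner ℂ y (T x + (l : ℂ) • (x : E)) = 0) → y = 0) :
    T.adjoint = T.closure := by
  have hle : T ≤ T.adjoint := LinearPMap.IsFormalAdjoint.le_adjoint hd hs
  have hacl : T.adjoint.IsClosed := LinearPMap.adjoint_isClosed hd
  have hcl : T.IsClosable := hacl.isClosable.leIsClosable hle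
  apply LinearPMap.eq_of_eq_graph
  rw [← hcl.graph_closure_eq_closure_graph]
  apply le_antisymm
  · rintro ⟨y, w⟩ hyw
    let B : T.domain →ₗ[ℂ] E := T.toFun + (l : ℂ) • T.domain.subtype
    have hB : ∀ x, B x = T x + (l : ℂ) • (x : E) := fun x => rfl
    have hR : Dense ((LinearMap.range B : Submodule ℂ E) : Set E) := by
      rw [Submodule.dense_iff_topologicalClosure_eq_top, Submodule.topologicalClosure_eq_top_iff,
        Submodule.eq_bot_iff]
      intro y hy
      apply hk
      intro x
      rw [Submodule.mem_orthogonal'] at hy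
      exact hy _ ⟨x, rfl⟩
    obtain ⟨z, hz, hzl⟩ := mem_closure_iff_seq_limit.1 (hR (w + (l : ℂ) • y))
    choose x hx using hz
    have hcz : CauchySeq z := hzl.cauchySeq
    have hcx : CauchySeq (fun n => (x n : E)) := by
      rw [Metric.cauchySeq_iff] at hcz ⊢
      intro ε hε
      obtain ⟨N, hN⟩ := hcz ε hε
      refine ⟨N, fun p hp q hq => lt_of_le_of_lt ?_ (hN p hp q hq)⟩
      rw [dist_eq_norm, dist_eq_norm, ← hx, ← hx, ← map_sub]
      exact hb (x p - x q)
    obtain ⟨x0, hx0⟩ := cauchySeq_tendsto_of_complete hcx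
    have hT : Filter.Tendsto (fun n => T (x n)) Filter.atTop
        (nhds (w + (l : ℂ) • y - (l : ℂ) • x0)) := by
      have := hzl.sub (hx0.const_smul (l : ℂ))
      refine this.congr fun n => ?_
      rw [← hx, hB]; simp
    have hmem : (x0, w + (l : ℂ) • y - (l : ℂ) • x0) ∈ T.graph.topologicalClosure := by
      apply mem_closure_of_tendsto (hx0.prodMk_nhds hT)
      filter_upwards with n
      exact T.mem_graph (x n)
    have hmem' : (x0, w + (l : ℂ) • y - (l : ℂ) • x0) ∈ T.adjoint.graph := by
      have h1 : T.graph.topologicalClosure ≤ T.adjoint.graph :=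
        Submodule.topologicalClosure_minimal _ (LinearPMap.le_graph_of_le hle) hacl
      exact h1 hmem
    have hsub := T.adjoint.graph.sub_mem hyw hmem'
    obtain ⟨v, hv1, hv2⟩ := (LinearPMap.mem_graph_iff _).1 hsub
    simp only [Prod.mk_sub_mk] at hv1 hv2
    have hzero : (v : E) = 0 := by
      apply hk
      intro x
      have h2 := LinearPMap.adjoint_isFormalAdjoint hd v x
      rw [inner_add_right, ← h2, hv2, hv1, ← inner_conj_symm _ ((l : ℂ) • (x : E)),
        inner_smul_left, map_mul, inner_conj_symm, ]
      have : w - (w + (l : ℂ) • y - (l : ℂ) • x0) = -((l : ℂ) • (y - x0)) := by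
        rw [smul_sub]; abel
      rw [this, inner_neg_left, inner_smul_left]
      simp
    have hyx : y = x0 := by rw [hv1] at hzero; exact sub_eq_zero.1 hzero
    subst hyx
    simpa using hmem
  · exact Submodule.topologicalClosure_minimal _ (LinearPMap.le_graph_of_le hle) hacl

theorem cpt_in_Ioo {c r0 : ℝ} {K : Set ℝ} (hK : IsCompact K) (hKI : K ⊆ Set.Ioi c) (hr : c < r0) :
    ∃ a b, c < a ∧ a < r0 ∧ r0 < b ∧ K ⊆ Set.Ioo a b := by
  have hK' : IsCompact (insert r0 K) := hK.insert r0
  have hne : (insert r0 K).Nonempty := ⟨r0, Set.mem_insert _ _⟩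
  obtain ⟨x, hx, hxl⟩ := hK'.exists_isLeast hne
  obtain ⟨y, hy, hyl⟩ := hK'.exists_isGreatest hne
  have hcx : c < x := by
    rcases hx with rfl | hx
    · exact hr
    · exact hKI hx
  refine ⟨(c + x) / 2, y + 1, by linarith, ?_, ?_, ?_⟩
  · have := hxl (Set.mem_insert r0 K); linarith
  · have := hyl (Set.mem_insert r0 K); linarith
  · intro z hz
    have h1 := hxl (Set.mem_insert_of_mem r0 hz)
    have h2 := hyl (Set.mem_insert_of_mem r0 hz)
    constructor <;> linarith

theorem cont_mul_cs {c : ℝ} {𝕜 : Type*} [RCLike 𝕜] {h N : ℝ → 𝕜} (hh : ContinuousOn h (Set.Ioi c)) (hN : Continuous N)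
    (hs : tsupport N ⊆ Set.Ioi c) : Continuous (fun x => h x * N x) := by
  apply continuous_of_tsupport
  intro x hx
  have hx' : x ∈ tsupport N := tsupport_mul_subset_right hx
  exact (hh.continuousAt (Ioi_mem_nhds (hs hx'))).mul hN.continuousAt

theorem int_mul_cs {c : ℝ} {𝕜 : Type*} [RCLike 𝕜] {h N : ℝ → 𝕜} (hh : ContinuousOn h (Set.Ioi c)) (hN : Continuous N)
    (hc : HasCompactSupport N) (hs : tsupport N ⊆ Set.Ioi c) :
    Integrable (fun x => h x * N x) :=
  (cont_mul_cs hh hN hs).integrable_of_hasCompactSupport (hc.mul_left)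

theorem locint_mul_cs {c : ℝ} {𝕜 : Type*} [RCLike 𝕜] {f N : ℝ → 𝕜} (hf : LocallyIntegrableOn f (Set.Ioi c))
    (hN : Continuous N)
    (hc : HasCompactSupport N) (hs : tsupport N ⊆ Set.Ioi c) :
    Integrable (fun x => f x * N x) := by
  have h1 : IntegrableOn f (tsupport N) := hf.integrableOn_compact_subset hs hc
  have h2 : IntegrableOn (fun x => f x * N x) (tsupport N) :=
    h1.mul_continuousOn hN.continuousOn hc
  rw [integrableOn_iff_integrable_of_support_subset] at h2
  · exact h2
  · exact (Function.support_mul_subset_right _ _).trans (subset_tsupport N)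

theorem prim_hasDerivAt {c r0 : ℝ} {h : ℝ → ℝ} (hh : ContinuousOn h (Set.Ioi c)) (hr : c < r0)
    {x : ℝ} (hx : c < x) : HasDerivAt (fun x => ∫ t in r0..x, h t) (h x) x := by
  apply intervalIntegral.integral_hasDerivAt_right
  · apply ContinuousOn.intervalIntegrable
    apply hh.mono
    intro y hy
    rcases Set.mem_uIcc.1 hy with h | h <;> simp only [Set.mem_Ioi] <;> linarith [h.1]
  · exact hh.stronglyMeasurableAtFilter isOpen_Ioi x hx
  · exact hh.continuousAt (Ioi_mem_nhds hx)

theorem ibp2 {c : ℝ} {H h N N' : ℝ → ℝ} (hH : ∀ x, c < x → HasDerivAt H (h x) x)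
    (hh : ContinuousOn h (Set.Ioi c)) (hN : ∀ x, HasDerivAt N (N' x) x) (hN' : Continuous N')
    (hc : HasCompactSupport N) (hs : tsupport N ⊆ Set.Ioi c) :
    ∫ x, H x * N' x = - ∫ x, h x * N x := by
  have hd : N' = deriv N := by ext x; exact (hN x).deriv.symm
  have hNc : Continuous N := continuous_iff_continuousAt.2 fun x => (hN x).continuousAt
  have hHc : ContinuousOn H (Set.Ioi c) := fun x hx => (hH x hx).continuousAt.continuousWithinAt
  have hsub : tsupport N' ⊆ Set.Ioi c := by
    rw [hd]; exact (closure_minimal (support_deriv_subset) (isClosed_tsupport N)).trans hs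
  apply integral_mul_deriv_eq_deriv_mul_of_integrable
  · intro x hx; exact hH x (hs hx)
  · intro x _; exact hN x
  · exact int_mul_cs hHc hN' (by rw [hd]; exact hc.deriv) hsub
  · exact int_mul_cs hh hNc hc hs
  · exact int_mul_cs hHc hNc hc hs

theorem locint_interval {c a b : ℝ} {g : ℝ → ℝ} (hg : LocallyIntegrableOn g (Set.Ioi c))
    (ha : c < a) (hb : c < b) : IntervalIntegrable g volume a b := by
  rw [intervalIntegrable_iff]
  apply (hg.integrableOn_compact_subset _ isCompact_uIcc).mono_set Set.uIoc_subset_uIcc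
  intro y hy
  rcases Set.mem_uIcc.1 hy with h | h <;> simp only [Set.mem_Ioi] <;> linarith [h.1]

theorem prim_cont {c r0 : ℝ} {g : ℝ → ℝ} (hg : LocallyIntegrableOn g (Set.Ioi c))
    (hr : c < r0) : ContinuousOn (fun x => ∫ t in r0..x, g t) (Set.Ioi c) := by
  intro x hx
  apply ContinuousAt.continuousWithinAt
  obtain ⟨a, b, ha, har, hb, hxx⟩ := cpt_in_Ioo (K := {x}) isCompact_singleton
    (by simpa using hx) hr
  have hx' : x ∈ Set.Ioo a b := hxx rfl
  have hab : a ≤ b := by linarith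
  have := intervalIntegral.continuousOn_primitive_interval' (a := r0)
    (locint_interval hg ha (hr.trans hb)) (by rw [Set.uIcc_of_le hab]; exact ⟨har.le, hb.le⟩)
  rw [Set.uIcc_of_le hab] at this
  exact this.continuousAt (Icc_mem_nhds hx'.1 hx'.2)

theorem ibp1 {c r0 : ℝ} {g φ : ℝ → ℝ} (hg : LocallyIntegrableOn g (Set.Ioi c)) (hr : c < r0)
    (hφ : ContDiff ℝ 1 φ) (hc : HasCompactSupport φ) (hs : tsupport φ ⊆ Set.Ioi c) :
    ∫ x, g x * φ x = - ∫ x, (∫ t in r0..x, g t) * deriv φ x := by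
  obtain ⟨a, b, ha, har, hb, hK⟩ := cpt_in_Ioo hc hs hr
  have hab : a ≤ b := by linarith
  have hgi := locint_interval hg ha (hr.trans hb)
  have hr0 : r0 ∈ Set.uIcc a b := by rw [Set.uIcc_of_le hab]; exact ⟨har.le, hb.le⟩
  have hG := hgi.absolutelyContinuousOnInterval_intervalIntegral hr0
  have hP : AbsolutelyContinuousOnInterval φ a b :=
    ContDiffOn.absolutelyContinuousOnInterval hφ.contDiffOn
  have key := hG.integral_mul_deriv_eq_deriv_mul hP
  have hφa : φ a = 0 := image_eq_zero_of_notMem_tsupport fun h => (lt_irrefl _ (hK h).1)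
  have hφb : φ b = 0 := image_eq_zero_of_notMem_tsupport fun h => (lt_irrefl _ (hK h).2)
  rw [hφa, hφb] at key
  simp only [mul_zero, sub_zero, zero_sub] at key
  have e1 : ∫ x in a..b, deriv (fun x => ∫ t in r0..x, g t) x * φ x = ∫ x in a..b, g x * φ x := by
    apply intervalIntegral.integral_congr_ae
    filter_upwards [hgi.ae_hasDerivAt_integral] with x hx hxm
    rw [(hx (Set.uIoc_subset_uIcc hxm) r0 hr0).deriv]
  rw [e1] at key
  have hsub : tsupport φ ⊆ Set.Ioc a b := hK.trans Set.Ioo_subset_Ioc_self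
  rw [intervalIntegral.integral_eq_integral_of_support_subset,
    intervalIntegral.integral_eq_integral_of_support_subset] at key
  · linarith
  · exact (Function.support_mul_subset_right _ _).trans ((subset_tsupport φ).trans hsub)
  · exact (Function.support_mul_subset_right _ _).trans (support_deriv_subset.trans hsub)

theorem prim_zero {a b : ℝ} {η : ℝ → ℝ} (hs : Function.support η ⊆ Set.Ioo a b)
    (h0 : ∫ x, η x = 0) : Function.support (fun x => ∫ t in a..x, η t) ⊆ Set.Ioo a b := by
  intro x hx
  by_contra hn
  apply hx
  rcases le_or_gt x a with h | h
  · show ∫ t in a..x, η t = 0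
    rw [intervalIntegral.integral_congr (g := fun _ => (0 : ℝ)), intervalIntegral.integral_zero]
    intro t ht
    rw [Set.uIcc_of_ge h] at ht
    by_contra h1
    have := (hs h1).1
    linarith [ht.2]
  · have hb : b ≤ x := by
      by_contra h1
      exact hn ⟨h, not_le.1 h1⟩
    show ∫ t in a..x, η t = 0
    rw [intervalIntegral.integral_eq_integral_of_support_subset, h0]
    exact hs.trans fun t ht => ⟨ht.1, by linarith [ht.2]⟩

theorem prim_contDiff {a : ℝ} {h : ℝ → ℝ} (hh : Continuous h) (x : ℝ) :
    HasDerivAt (fun x => ∫ t in a..x, h t) (h x) x :=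
  intervalIntegral.integral_hasDerivAt_right (hh.intervalIntegrable _ _)
    (hh.stronglyMeasurableAtFilter _ _) hh.continuousAt

theorem exists_test {c r0 : ℝ} {D η : ℝ → ℝ} (hr : c < r0) (hD : ContDiff ℝ 2 D)
    (hpos : ∀ x, c < x → 0 < D x) (hη : Continuous η) (hc : HasCompactSupport η)
    (hs : tsupport η ⊆ Set.Ioi c) (h0 : ∫ x, η x = 0)
    (h1 : ∫ x, (∫ t in r0..x, 1 / D t) * η x = 0) :
    ∃ φ : ℝ → ℝ, ContDiff ℝ 2 φ ∧ HasCompactSupport φ ∧ tsupport φ ⊆ Set.Ioi c ∧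
      deriv (fun y => D y * deriv φ y) = η := by
  obtain ⟨a, b, ha, har, hb, hK⟩ := cpt_in_Ioo hc hs hr
  have hsup : Function.support η ⊆ Set.Ioo a b := (subset_tsupport η).trans hK
  have cptI : ∀ N : ℝ → ℝ, Function.support N ⊆ Set.Ioo a b →
      HasCompactSupport N ∧ tsupport N ⊆ Set.Icc a b ∧ tsupport N ⊆ Set.Ioi c := by
    intro N hN
    have h2 : tsupport N ⊆ Set.Icc a b :=
      closure_minimal (hN.trans Set.Ioo_subset_Icc_self) isClosed_Icc
    exact ⟨isCompact_Icc.of_isClosed_subset (isClosed_tsupport N) h2, h2,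
      h2.trans fun t ht => lt_of_lt_of_le ha ht.1⟩
  set N : ℝ → ℝ := fun x => ∫ t in a..x, η t with hNdef
  have hNd : ∀ x, HasDerivAt N (η x) x := prim_contDiff hη
  have hNs : Function.support N ⊆ Set.Ioo a b := prim_zero hsup h0
  obtain ⟨hNc, hNI, hNI'⟩ := cptI N hNs
  have hN1 : ContDiff ℝ 1 N := by
    rw [contDiff_one_iff_deriv]
    refine ⟨fun x => (hNd x).differentiableAt, ?_⟩
    have : deriv N = η := by ext x; exact (hNd x).deriv
    rw [this]; exact hη
  set P : ℝ → ℝ := fun x => 1 / D x * N x with hP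
  have hDc : ContinuousOn (fun x => 1 / D x) (Set.Ioi c) :=
    continuousOn_const.div hD.continuous.continuousOn fun x hx => (hpos x hx).ne'
  have hPs : Function.support P ⊆ Set.Ioo a b := (Function.support_mul_subset_right _ _).trans hNs
  obtain ⟨hPc, hPI, hPI'⟩ := cptI P hPs
  have hP1 : ContDiff ℝ 1 P := by
    rw [contDiff_iff_contDiffAt]
    intro x
    rcases lt_or_ge c x with h | h
    · apply ContDiffAt.mul _ hN1.contDiffAt
      exact contDiffAt_const.div (hD.contDiffAt.of_le (by norm_num)) (hpos x h).ne'
    · have : x ∉ tsupport P := fun h2 => absurd (hPI' h2) (not_lt.2 h)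
      rw [notMem_tsupport_iff_eventuallyEq] at this
      exact contDiffAt_const.congr_of_eventuallyEq this
  have hPint : ∫ x, P x = 0 := by
    have := ibp2 (c := c) (fun x hx => prim_hasDerivAt hDc hr hx) hDc hNd hη hNc hNI'
    rw [h1] at this
    linarith
  set φ : ℝ → ℝ := fun x => ∫ t in a..x, P t with hφdef
  have hφd : ∀ x, HasDerivAt φ (P x) x := prim_contDiff hP1.continuous
  have hφs : Function.support φ ⊆ Set.Ioo a b := prim_zero hPs hPint
  obtain ⟨hφc, hφI, hφI'⟩ := cptI φ hφs
  have hder : deriv φ = P := by ext x; exact (hφd x).deriv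
  refine ⟨φ, ?_, hφc, hφI', ?_⟩
  · rw [show (2 : WithTop ℕ∞) = 1 + 1 by norm_num, contDiff_succ_iff_deriv]
    refine ⟨fun x => (hφd x).differentiableAt, by simp, by rw [hder]; exact hP1⟩
  · have : (fun y => D y * deriv φ y) = N := by
      ext y
      rw [hder]
      by_cases hy : y ∈ Set.Ioo a b
      · have := (hpos y (ha.trans hy.1)).ne'
        simp only [hP]; field_simp
      · have : N y = 0 := by by_contra h2; exact hy (hNs h2)
        simp [hP, this]
    rw [this]
    ext x; exact (hNd x).deriv

/-- Continuous compactly supported functions with support in `(c, ∞)`. -/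
def testSpace (c : ℝ) : Submodule ℝ (ℝ → ℝ) where
  carrier := {η | Continuous η ∧ HasCompactSupport η ∧ tsupport η ⊆ Set.Ioi c}
  zero_mem' := by
    refine ⟨continuous_const, HasCompactSupport.zero, ?_⟩
    simp [tsupport]
  add_mem' := by
    rintro f g ⟨h1, h2, h3⟩ ⟨g1, g2, g3⟩
    exact ⟨h1.add g1, h2.add g2, (tsupport_add f g).trans (Set.union_subset h3 g3)⟩
  smul_mem' := by
    rintro t f ⟨h1, h2, h3⟩
    refine ⟨h1.const_smul t, h2.smul_left (f := fun _ => t), ?_⟩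
    exact (tsupport_smul_subset_right (fun _ => t) f).trans h3

/-- Integration against a locally integrable function. -/
noncomputable def testFun {c : ℝ} {k : ℝ → ℝ} (hk : LocallyIntegrableOn k (Set.Ioi c)) :
    testSpace c →ₗ[ℝ] ℝ where
  toFun η := ∫ x, k x * (η : ℝ → ℝ) x
  map_add' := by
    rintro ⟨f, h1, h2, h3⟩ ⟨g, g1, g2, g3⟩
    simp only [Submodule.coe_add, Pi.add_apply, mul_add]
    exact integral_add (locint_mul_cs hk h1 h2 h3) (locint_mul_cs hk g1 g2 g3)
  map_smul' := by
    rintro t ⟨f, h1, h2, h3⟩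
    simp only [Submodule.coe_smul, Pi.smul_apply, smul_eq_mul, RingHom.id_apply]
    rw [← integral_const_mul]
    congr 1; ext x; ring

theorem weak_reg {c : ℝ} {D Q f : ℝ → ℝ} (hD : ContDiff ℝ 2 D)
    (hpos : ∀ x, c < x → 0 < D x) (hQ : ContinuousOn Q (Set.Ioi c))
    (hf : LocallyIntegrableOn f (Set.Ioi c))
    (hw : ∀ φ : ℝ → ℝ, ContDiff ℝ 2 φ → HasCompactSupport φ → tsupport φ ⊆ Set.Ioi c →
      ∫ x, f x * (deriv (fun y => D y * deriv φ y) x - Q x * φ x) = 0) :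
    ∃ v p : ℝ → ℝ, (∀ᵐ x, x ∈ Set.Ioi c → f x = v x) ∧
      ∀ x, c < x → HasDerivAt v (p x / D x) x ∧ HasDerivAt p (Q x * v x) x := by
  obtain ⟨r0, hr⟩ : ∃ r0, c < r0 := ⟨c + 1, by linarith⟩
  have hlc : IsLocallyClosed (Set.Ioi c) := isOpen_Ioi.isLocallyClosed
  have hg : LocallyIntegrableOn (fun x => Q x * f x) (Set.Ioi c) := hf.continuousOn_mul hQ hlc
  set G : ℝ → ℝ := fun x => ∫ t in r0..x, Q t * f t with hGdef
  have hGc : ContinuousOn G (Set.Ioi c) := prim_cont hg hr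
  have hDc : ContinuousOn (fun x => 1 / D x) (Set.Ioi c) :=
    continuousOn_const.div hD.continuous.continuousOn fun x hx => (hpos x hx).ne'
  have hGDc : ContinuousOn (fun x => G x / D x) (Set.Ioi c) :=
    hGc.div hD.continuous.continuousOn fun x hx => (hpos x hx).ne'
  set H : ℝ → ℝ := fun x => ∫ t in r0..x, G t / D t with hHdef
  have hHd : ∀ x, c < x → HasDerivAt H (G x / D x) x := fun x hx => prim_hasDerivAt hGDc hr hx
  have hHc : ContinuousOn H (Set.Ioi c) := fun x hx => (hHd x hx).continuousAt.continuousWithinAt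
  set S : ℝ → ℝ := fun x => ∫ t in r0..x, 1 / D t with hSdef
  have hSd : ∀ x, c < x → HasDerivAt S (1 / D x) x := fun x hx => prim_hasDerivAt hDc hr hx
  have hSc : ContinuousOn S (Set.Ioi c) := fun x hx => (hSd x hx).continuousAt.continuousWithinAt
  have hH : LocallyIntegrableOn H (Set.Ioi c) := hHc.locallyIntegrableOn measurableSet_Ioi
  have hS : LocallyIntegrableOn S (Set.Ioi c) := hSc.locallyIntegrableOn measurableSet_Ioi
  have h1 : LocallyIntegrableOn (fun _ => (1 : ℝ)) (Set.Ioi c) :=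
    continuousOn_const.locallyIntegrableOn measurableSet_Ioi
  have hk : LocallyIntegrableOn (fun x => f x - H x) (Set.Ioi c) := hf.sub hH
  -- second order du Bois-Reymond
  have hk0 : ∀ φ : ℝ → ℝ, ContDiff ℝ 2 φ → HasCompactSupport φ → tsupport φ ⊆ Set.Ioi c →
      ∫ x, (f x - H x) * deriv (fun y => D y * deriv φ y) x = 0 := by
    intro φ hφ hc hs
    have hφ1 : ContDiff ℝ 1 φ := hφ.of_le (by norm_num)
    have hdφ : ContDiff ℝ 1 (deriv φ) := by
      have : ContDiff ℝ (1 + 1) φ := by norm_num; exact hφ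
      exact (contDiff_succ_iff_deriv.1 this).2.2
    have hN1 : ContDiff ℝ 1 (fun y => D y * deriv φ y) := (hD.of_le (by norm_num)).mul hdφ
    have hNc : HasCompactSupport (fun y => D y * deriv φ y) := hc.deriv.mul_left
    have hdsub : tsupport (deriv φ) ⊆ Set.Ioi c :=
      (closure_minimal support_deriv_subset (isClosed_tsupport φ)).trans hs
    have hNs : tsupport (fun y => D y * deriv φ y) ⊆ Set.Ioi c :=
      (tsupport_mul_subset_right).trans hdsub
    have hN'c : Continuous (deriv (fun y => D y * deriv φ y)) := hN1.continuous_deriv le_rfl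
    have hN's : tsupport (deriv (fun y => D y * deriv φ y)) ⊆ Set.Ioi c :=
      (closure_minimal support_deriv_subset (isClosed_tsupport _)).trans hNs
    have i1 := locint_mul_cs hf hN'c hNc.deriv hN's
    have i2 := locint_mul_cs hH hN'c hNc.deriv hN's
    have i3 := locint_mul_cs hg hφ.continuous hc hs
    have e1 := hw φ hφ hc hs
    have e2 : ∫ x, f x * deriv (fun y => D y * deriv φ y) x = ∫ x, (Q x * f x) * φ x := by
      rw [← sub_eq_zero, ← integral_sub i1 i3, ← e1]
      congr 1; ext x; ring
    have e3 := ibp1 hg hr hφ1 hc hs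
    have e4 := ibp2 hHd hGDc (fun x => (hN1.differentiable one_ne_zero x).hasDerivAt) hN'c hNc hNs
    have e5 : ∫ x, G x / D x * (D x * deriv φ x) = ∫ x, G x * deriv φ x := by
      congr 1; ext x
      by_cases hx : c < x
      · have := (hpos x hx).ne'
        field_simp
      · have : deriv φ x = 0 := image_eq_zero_of_notMem_tsupport fun h => hx (hdsub h)
        simp [this]
    simp only [sub_mul]
    rw [integral_sub i1 i2, e2, e3, e4, e5, sub_neg_eq_add]
    exact neg_add_cancel _
  have hspan := mem_span_of_iInf_ker_le_ker (L := ![testFun h1, testFun hS]) (K := testFun hk) (by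
    rintro ⟨η, n1, n2, n3⟩ hη
    simp only [Submodule.mem_iInf, Fin.forall_fin_two, LinearMap.mem_ker, testFun,
      Matrix.cons_val_zero, Matrix.cons_val_one, LinearMap.coe_mk, AddHom.coe_mk, one_mul] at hη ⊢
    obtain ⟨φ, p1, p2, p3, p4⟩ := exists_test hr hD hpos n1 n2 n3 hη.1 hη.2
    have := hk0 φ p1 p2 p3
    rwa [p4] at this)
  rw [Matrix.range_cons, Matrix.range_cons, Matrix.range_empty, Set.union_empty,
    Set.singleton_union, Submodule.mem_span_pair] at hspan
  obtain ⟨c1, c2, hcc⟩ := hspan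
  set v : ℝ → ℝ := fun x => H x + c1 + c2 * S x with hv
  have hvd : ∀ x, c < x → HasDerivAt v ((G x + c2) / D x) x := by
    intro x hx
    have := ((hHd x hx).add_const c1).add ((hSd x hx).const_mul c2)
    refine HasDerivAt.congr_deriv this ?_
    ring
  have hvc : ContinuousOn v (Set.Ioi c) := fun x hx => (hvd x hx).continuousAt.continuousWithinAt
  have hfv : ∀ᵐ x, x ∈ Set.Ioi c → f x - v x = 0 := by
    apply isOpen_Ioi.ae_eq_zero_of_integral_contDiff_smul_eq_zero
    · exact hf.sub (hvc.locallyIntegrableOn measurableSet_Ioi)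
    · intro η n1 n2 n3
      have := LinearMap.congr_fun hcc ⟨η, n1.continuous, n2, n3⟩
      simp only [testFun, LinearMap.add_apply, LinearMap.smul_apply, LinearMap.coe_mk,
        AddHom.coe_mk, smul_eq_mul] at this
      have j1 := locint_mul_cs hk n1.continuous n2 n3
      have j2 := (locint_mul_cs h1 n1.continuous n2 n3).const_mul c1
      have j3 := (locint_mul_cs hS n1.continuous n2 n3).const_mul c2
      have j4 : Integrable (fun x => c1 * (1 * η x) + c2 * (S x * η x)) := j2.add j3
      rw [← integral_const_mul, ← integral_const_mul, ← integral_add j2 j3, eq_comm,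
        ← sub_eq_zero, ← integral_sub j1 j4] at this
      rw [← this]
      congr 1; ext x; simp only [hv, smul_eq_mul]; ring
  have hGv : ∀ x, c < x → G x = ∫ t in r0..x, Q t * v t := by
    intro x hx
    apply intervalIntegral.integral_congr_ae
    filter_upwards [hfv] with t ht htm
    have : c < t := by
      rcases Set.mem_uIcc.1 (Set.uIoc_subset_uIcc htm) with h | h <;> linarith [h.1]
    rw [sub_eq_zero.1 (ht this)]
  refine ⟨v, fun x => G x + c2, ?_, fun x hx => ⟨hvd x hx, ?_⟩⟩
  · filter_upwards [hfv] with x hx hxI using sub_eq_zero.1 (hx hxI)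
  · apply HasDerivAt.add_const
    apply (prim_hasDerivAt (hQ.mul hvc) hr hx).congr_of_eventuallyEq
    filter_upwards [Ioi_mem_nhds hx] with y hy using hGv y hy

theorem sol_zero {c : ℝ} {D Q w v p : ℝ → ℝ} (hpos : ∀ x, c < x → 0 < D x)
    (hQ : ∀ x, c < x → 0 ≤ Q x)
    (hv : ∀ x, c < x → HasDerivAt v (p x / D x) x) (hp : ∀ x, c < x → HasDerivAt p (Q x * v x) x)
    (hw0 : ∀ x, c < x → 0 ≤ w x) (hwm : Measurable w)
    (hint : IntegrableOn (fun x => v x ^ 2 * w x) (Set.Ioi c))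
    (hl : ∀ r, c < r → ¬ IntegrableOn w (Set.Ioo c r))
    (hr : ∀ r, c < r → ¬ IntegrableOn w (Set.Ioi r)) :
    ∀ x, c < x → v x = 0 := by
  intro r hcr
  by_contra hne
  have hsq : 0 < v r ^ 2 := by positivity
  have hvp : ∀ x, c < x → HasDerivAt (fun x => v x * p x) (p x ^ 2 / D x + Q x * v x ^ 2) x := by
    intro x hx
    refine ((hv x hx).mul (hp x hx)).congr_deriv ?_
    ring
  have hmono : MonotoneOn (fun x => v x * p x) (Set.Ioi c) := by
    apply monotoneOn_of_deriv_nonneg (convex_Ioi c)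
    · exact fun x hx => (hvp x hx).continuousAt.continuousWithinAt
    · rw [interior_Ioi]
      exact fun x hx => (hvp x hx).differentiableAt.differentiableWithinAt
    · rw [interior_Ioi]
      intro x hx
      rw [(hvp x hx).deriv]
      have h1 := hpos x hx
      have h2 := hQ x hx
      positivity
  have hsd : ∀ x, c < x → HasDerivAt (fun x => v x ^ 2) (2 * (v x * p x) / D x) x := by
    intro x hx
    refine ((hv x hx).pow 2).congr_deriv ?_
    simp; ring
  have key : ∀ s ⊆ Set.Ioi c, MeasurableSet s → (∀ x ∈ s, v r ^ 2 ≤ v x ^ 2) →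
      IntegrableOn w s := by
    intro s hs hsm hsv
    have h1 : IntegrableOn (fun x => (v r ^ 2)⁻¹ * (v x ^ 2 * w x)) s :=
      (hint.mono_set hs).const_mul _
    apply Integrable.mono' h1 hwm.aestronglyMeasurable
    filter_upwards [ae_restrict_mem hsm] with x hx
    have h2 := hw0 x (hs hx)
    rw [Real.norm_of_nonneg h2, le_inv_mul_iff₀ hsq]
    exact mul_le_mul_of_nonneg_right (hsv x hx) h2
  rcases le_or_gt 0 (v r * p r) with h | h
  · apply hr r hcr
    apply key _ (Set.Ioi_subset_Ioi hcr.le) measurableSet_Ioi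
    have : MonotoneOn (fun x => v x ^ 2) (Set.Ici r) := by
      apply monotoneOn_of_deriv_nonneg (convex_Ici r)
      · exact fun x hx => (hsd x (hcr.trans_le hx)).continuousAt.continuousWithinAt
      · rw [interior_Ici]
        exact fun x hx => (hsd x (hcr.trans hx)).differentiableAt.differentiableWithinAt
      · rw [interior_Ici]
        intro x hx
        have hx' : c < x := hcr.trans hx
        rw [(hsd x hx').deriv]
        have h1 := hpos x hx'
        have h2 : v r * p r ≤ v x * p x := hmono hcr hx' (le_of_lt hx)
        have h3 : 0 ≤ v x * p x := h.trans h2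
        positivity
    intro x hx
    exact this Set.self_mem_Ici (Set.mem_Ici.2 (le_of_lt hx)) (le_of_lt hx)
  · apply hl r hcr
    apply key _ Set.Ioo_subset_Ioi_self measurableSet_Ioo
    have : AntitoneOn (fun x => v x ^ 2) (Set.Ioc c r) := by
      apply antitoneOn_of_deriv_nonpos (convex_Ioc c r)
      · exact fun x hx => (hsd x hx.1).continuousAt.continuousWithinAt
      · rw [interior_Ioc]
        exact fun x hx => (hsd x hx.1).differentiableAt.differentiableWithinAt
      · rw [interior_Ioc]
        intro x hx
        rw [(hsd x hx.1).deriv]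
        have h1 := hpos x hx.1
        have h2 : v x * p x ≤ v r * p r := hmono hx.1 hcr (le_of_lt hx.2)
        apply div_nonpos_of_nonpos_of_nonneg _ h1.le
        linarith
    intro x hx
    exact this ⟨hx.1, hx.2.le⟩ ⟨hcr, le_rfl⟩ hx.2.le

theorem kerr_facts {M a : ℝ} (hM : 0 < M) (ha : 0 ≤ a) (haM : a ≤ M) :
    0 < rPlus M a ∧ (∀ x, rPlus M a < x → 0 < kerrDelta M a x) ∧
    (∀ x, rPlus M a < x → kerrDelta M a x ≤ x ^ 2) ∧
    (∀ x, rPlus M a < x → kerrDelta M a x ≤ (x - rPlus M a) * x) := by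
  have hs := Real.sqrt_nonneg (M ^ 2 - a ^ 2)
  have hs2 : Real.sqrt (M ^ 2 - a ^ 2) ^ 2 = M ^ 2 - a ^ 2 := Real.sq_sqrt (by nlinarith)
  simp only [rPlus, kerrDelta]
  set s := Real.sqrt (M ^ 2 - a ^ 2) with hsdef
  have hsM : s ≤ M := by nlinarith
  refine ⟨by linarith, fun x hx => ?_, fun x hx => ?_, fun x hx => ?_⟩
  · nlinarith
  · nlinarith
  · nlinarith

theorem kerr_contDiff (M a : ℝ) {n : WithTop ℕ∞} : ContDiff ℝ n (kerrDelta M a) := by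
  unfold kerrDelta
  fun_prop

theorem weight_lb {M a : ℝ} (hM : 0 < M) (ha : 0 ≤ a) (haM : a ≤ M) {x : ℝ}
    (hx : rPlus M a < x) : rPlus M a ^ 2 ≤ x ^ 4 / kerrDelta M a x := by
  obtain ⟨h0, h1, h2, h3⟩ := kerr_facts hM ha haM
  rw [le_div_iff₀ (h1 x hx)]
  have e1 : rPlus M a ^ 2 ≤ x ^ 2 := by gcongr
  calc rPlus M a ^ 2 * kerrDelta M a x ≤ x ^ 2 * x ^ 2 :=
        mul_le_mul e1 (h2 x hx) (h1 x hx).le (by positivity)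
    _ = x ^ 4 := by ring

theorem weight_meas (M a : ℝ) : Measurable (fun x => x ^ 4 / kerrDelta M a x) := by
  have := (kerr_contDiff M a (n := 0)).continuous.measurable
  fun_prop

theorem weight_cont {M a : ℝ} (hM : 0 < M) (ha : 0 ≤ a) (haM : a ≤ M) :
    ContinuousOn (fun x => x ^ 4 / kerrDelta M a x) (Set.Ioi (rPlus M a)) := by
  have h1 := (kerr_facts hM ha haM).2.1
  exact (continuousOn_pow 4).div (kerr_contDiff M a (n := 0)).continuous.continuousOn
    fun x hx => (h1 x hx).ne'

theorem weight_not_right {M a : ℝ} (hM : 0 < M) (ha : 0 ≤ a) (haM : a ≤ M) {r : ℝ}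
    (hr : rPlus M a < r) : ¬ IntegrableOn (fun x => x ^ 4 / kerrDelta M a x) (Set.Ioi r) := by
  intro h
  have h0 := (kerr_facts hM ha haM).1
  have h1 : IntegrableOn (fun _ => rPlus M a ^ 2) (Set.Ioi r) := by
    apply Integrable.mono' h aestronglyMeasurable_const
    filter_upwards [ae_restrict_mem measurableSet_Ioi] with x hx
    rw [Real.norm_of_nonneg (by positivity)]
    exact weight_lb hM ha haM (hr.trans hx)
  rw [integrableOn_const_iff] at h1
  simp at h1
  exact h0.ne' h1

theorem weight_not_left {M a : ℝ} (hM : 0 < M) (ha : 0 ≤ a) (haM : a ≤ M) {r : ℝ}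
    (hr : rPlus M a < r) :
    ¬ IntegrableOn (fun x => x ^ 4 / kerrDelta M a x) (Set.Ioo (rPlus M a) r) := by
  intro h
  obtain ⟨h0, h1, h2, h3⟩ := kerr_facts hM ha haM
  have h4 : IntegrableOn (fun x => (x - rPlus M a)⁻¹) (Set.Ioo (rPlus M a) r) := by
    have h5 : IntegrableOn (fun x => (rPlus M a ^ 3)⁻¹ * (x ^ 4 / kerrDelta M a x))
      (Set.Ioo (rPlus M a) r) := h.const_mul _
    apply Integrable.mono' h5
    · exact ((measurable_id.sub_const _).inv).aestronglyMeasurable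
    filter_upwards [ae_restrict_mem measurableSet_Ioo] with x hx
    have hx1 : 0 < x - rPlus M a := sub_pos.2 hx.1
    have hx0 : 0 < x := h0.trans hx.1
    rw [Real.norm_of_nonneg (by positivity), le_inv_mul_iff₀ (by positivity),
      ← div_eq_mul_inv, div_le_div_iff₀ hx1 (h1 x hx.1)]
    calc rPlus M a ^ 3 * kerrDelta M a x ≤ x ^ 3 * ((x - rPlus M a) * x) := by
          apply mul_le_mul _ (h3 x hx.1) (h1 x hx.1).le (by positivity)
          have := hx.1.le
          gcongr
      _ = x ^ 4 * (x - rPlus M a) := by ring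
  rw [← integrableOn_Ioc_iff_integrableOn_Ioo, ← intervalIntegrable_iff_integrableOn_Ioc_of_le hr.le,
    intervalIntegrable_sub_inv_iff] at h4
  rcases h4 with h4 | h4
  · exact hr.ne h4
  · exact h4 Set.left_mem_uIcc

theorem radialMeasure_eq (M a : ℝ) : radialMeasure M a =
    ((volume : Measure ℝ).restrict (Set.Ioi (rPlus M a))).withDensity
      (fun r => ENNReal.ofReal (r ^ 4 / kerrDelta M a r)) :=
  restrict_withDensity measurableSet_Ioi _

theorem radial_integral {M a : ℝ} (hM : 0 < M) (ha : 0 ≤ a) (haM : a ≤ M) (F : ℝ → ℂ) :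
    ∫ x, F x ∂(radialMeasure M a) =
      ∫ x in Set.Ioi (rPlus M a), ((x ^ 4 / kerrDelta M a x : ℝ) : ℂ) * F x := by
  rw [radialMeasure_eq, integral_withDensity_eq_integral_toReal_smul
    (weight_meas M a).ennreal_ofReal (by simp)]
  apply setIntegral_congr_fun measurableSet_Ioi
  intro x hx
  have := weight_lb hM ha haM hx
  simp only
  rw [ENNReal.toReal_ofReal (le_trans (by positivity) this), Complex.real_smul]

theorem radial_integrable {M a : ℝ} (hM : 0 < M) (ha : 0 ≤ a) (haM : a ≤ M) {F : ℝ → ℝ} :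
    Integrable F (radialMeasure M a) ↔
      IntegrableOn (fun x => x ^ 4 / kerrDelta M a x * F x) (Set.Ioi (rPlus M a)) := by
  rw [radialMeasure_eq, integrable_withDensity_iff_integrable_smul'
    (weight_meas M a).ennreal_ofReal (by simp)]
  apply integrableOn_congr_fun _ measurableSet_Ioi
  intro x hx
  have := weight_lb hM ha haM hx
  simp only
  rw [ENNReal.toReal_ofReal (le_trans (by positivity) this), smul_eq_mul]

theorem radial_ae {M a : ℝ} {P : ℝ → Prop} (h : ∀ᵐ x, x ∈ Set.Ioi (rPlus M a) → P x) :
    ∀ᵐ x ∂(radialMeasure M a), P x := by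
  rw [radialMeasure_eq]
  apply (withDensity_absolutelyContinuous _ _).ae_le
  exact (ae_restrict_iff' measurableSet_Ioi).2 h

theorem radial_memLp {M a : ℝ} (hM : 0 < M) (ha : 0 ≤ a) (haM : a ≤ M) {u : ℝ → ℂ}
    (hu : Continuous u) (hc : HasCompactSupport u) (hs : tsupport u ⊆ Set.Ioi (rPlus M a)) :
    MemLp u 2 (radialMeasure M a) := by
  rw [memLp_two_iff_integrable_sq_norm hu.aestronglyMeasurable, radial_integrable hM ha haM]
  apply Integrable.integrableOn
  have hsup : tsupport (fun x => ‖u x‖ ^ 2) ⊆ tsupport u := by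
    apply closure_mono
    intro x hx h
    apply hx
    simp [h]
  apply int_mul_cs (weight_cont hM ha haM) (hu.norm.pow 2)
  · exact hc.mono' (subset_closure.trans hsup)
  · exact hsup.trans hs

theorem radial_lp_sq {M a : ℝ} (hM : 0 < M) (ha : 0 ≤ a) (haM : a ≤ M)
    (y : Lp ℂ 2 (radialMeasure M a)) :
    IntegrableOn (fun x => x ^ 4 / kerrDelta M a x * ‖y x‖ ^ 2) (Set.Ioi (rPlus M a)) := by
  rw [← radial_integrable hM ha haM]
  exact (memLp_two_iff_integrable_sq_norm (Lp.aestronglyMeasurable y)).1 (Lp.memLp y)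

theorem radial_locint {M a : ℝ} (hM : 0 < M) (ha : 0 ≤ a) (haM : a ≤ M)
    (y : Lp ℂ 2 (radialMeasure M a)) :
    LocallyIntegrableOn (y : ℝ → ℂ) (Set.Ioi (rPlus M a)) := by
  have h0 := (kerr_facts hM ha haM).1
  have hm : StronglyMeasurable (y : ℝ → ℂ) := Lp.stronglyMeasurable y
  have h1 : MemLp (y : ℝ → ℂ) 2 (volume.restrict (Set.Ioi (rPlus M a))) := by
    rw [memLp_two_iff_integrable_sq_norm hm.aestronglyMeasurable]
    apply Integrable.mono' ((radial_lp_sq hM ha haM y).const_mul (rPlus M a ^ 2)⁻¹)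
    · exact (hm.norm.pow 2).aestronglyMeasurable
    filter_upwards [ae_restrict_mem measurableSet_Ioi] with x hx
    rw [Real.norm_of_nonneg (by positivity), le_inv_mul_iff₀ (by positivity)]
    exact mul_le_mul_of_nonneg_right (weight_lb hM ha haM hx) (by positivity)
  exact locallyIntegrableOn_of_locallyIntegrable_restrict (h1.locallyIntegrable (by norm_num))

/-- The differential expression without the weight. -/
noncomputable def sturm (M a : ℝ) (m : ℤ) (u : ℝ → ℂ) (r : ℝ) : ℂ :=
  -deriv (fun x => ((kerrDelta M a x : ℝ) : ℂ) * deriv u x) r -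
      (((m : ℝ) ^ 2 * a ^ 2 / kerrDelta M a r : ℝ) : ℂ) * u r

theorem kerr_inv_cont {M a : ℝ} (hM : 0 < M) (ha : 0 ≤ a) (haM : a ≤ M) (k : ℝ) :
    ContinuousOn (fun x => k / kerrDelta M a x) (Set.Ioi (rPlus M a)) :=
  continuousOn_const.div (kerr_contDiff M a (n := 0)).continuous.continuousOn
    fun x hx => ((kerr_facts hM ha haM).2.1 x hx).ne'

theorem flux_facts {M a : ℝ} {u : ℝ → ℂ} (hu : ContDiff ℝ 2 u)
    (hc : HasCompactSupport u) (hs : tsupport u ⊆ Set.Ioi (rPlus M a)) :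
    Continuous (deriv u) ∧ HasCompactSupport (deriv u) ∧ tsupport (deriv u) ⊆ Set.Ioi (rPlus M a) ∧
    ContDiff ℝ 1 (fun x => ((kerrDelta M a x : ℝ) : ℂ) * deriv u x) ∧
    HasCompactSupport (fun x => ((kerrDelta M a x : ℝ) : ℂ) * deriv u x) ∧
    Continuous (deriv (fun x => ((kerrDelta M a x : ℝ) : ℂ) * deriv u x)) ∧
    HasCompactSupport (deriv (fun x => ((kerrDelta M a x : ℝ) : ℂ) * deriv u x)) ∧
    tsupport (deriv (fun x => ((kerrDelta M a x : ℝ) : ℂ) * deriv u x)) ⊆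
      Set.Ioi (rPlus M a) := by
  have hd : ContDiff ℝ 1 (deriv u) := by
    have : ContDiff ℝ (1 + 1) u := by norm_num; exact hu
    exact (contDiff_succ_iff_deriv.1 this).2.2
  have h1 : ContDiff ℝ 1 (fun x => ((kerrDelta M a x : ℝ) : ℂ) * deriv u x) :=
    (Complex.ofRealCLM.contDiff.comp (kerr_contDiff M a)).mul hd
  have h2 : HasCompactSupport (fun x => ((kerrDelta M a x : ℝ) : ℂ) * deriv u x) :=
    hc.deriv.mul_left
  have h3 : tsupport (deriv u) ⊆ Set.Ioi (rPlus M a) :=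
    (closure_minimal support_deriv_subset (isClosed_tsupport u)).trans hs
  refine ⟨hd.continuous, hc.deriv, h3, h1, h2, h1.continuous_deriv le_rfl, h2.deriv, ?_⟩
  refine (closure_minimal support_deriv_subset (isClosed_tsupport _)).trans ?_
  exact tsupport_mul_subset_right.trans h3

theorem sturm_facts {M a : ℝ} (hM : 0 < M) (ha : 0 ≤ a) (haM : a ≤ M) (m : ℤ) {u : ℝ → ℂ}
    (hu : ContDiff ℝ 2 u) (hc : HasCompactSupport u) (hs : tsupport u ⊆ Set.Ioi (rPlus M a)) :
    Continuous (sturm M a m u) ∧ HasCompactSupport (sturm M a m u) ∧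
      tsupport (sturm M a m u) ⊆ Set.Ioi (rPlus M a) := by
  obtain ⟨-, -, -, -, -, f1, f2, f3⟩ := flux_facts hu hc hs
  have g1 : Continuous (fun r => (((m : ℝ) ^ 2 * a ^ 2 / kerrDelta M a r : ℝ) : ℂ) * u r) :=
    cont_mul_cs (Complex.continuous_ofReal.comp_continuousOn (kerr_inv_cont hM ha haM _))
      hu.continuous hs
  have g2 : HasCompactSupport
    (fun r => (((m : ℝ) ^ 2 * a ^ 2 / kerrDelta M a r : ℝ) : ℂ) * u r) := hc.mul_left
  have g3 : tsupport (fun r => (((m : ℝ) ^ 2 * a ^ 2 / kerrDelta M a r : ℝ) : ℂ) * u r) ⊆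
    Set.Ioi (rPlus M a) := tsupport_mul_subset_right.trans hs
  refine ⟨f1.neg.sub g1, f2.neg.sub g2, ?_⟩
  refine (tsupport_sub _ _).trans (Set.union_subset ?_ g3)
  rw [show tsupport (fun x => -deriv (fun x => ((kerrDelta M a x : ℝ) : ℂ) * deriv u x) x) =
    tsupport (deriv (fun x => ((kerrDelta M a x : ℝ) : ℂ) * deriv u x)) from tsupport_neg _]
  exact f3

theorem inner_op {M a : ℝ} (hM : 0 < M) (ha : 0 ≤ a) (haM : a ≤ M) (m : ℤ) {v y : ℝ → ℂ}
    (hu : ContDiff ℝ 2 v) (hc : HasCompactSupport v) (hs : tsupport v ⊆ Set.Ioi (rPlus M a))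
    {Y G : Lp ℂ 2 (radialMeasure M a)} (hY : (Y : ℝ → ℂ) =ᵐ[radialMeasure M a] y)
    (hG : (G : ℝ → ℂ) =ᵐ[radialMeasure M a] radialOp M a m v) :
    inner ℂ Y G = ∫ x, (starRingEnd ℂ) (y x) * sturm M a m v x := by
  obtain ⟨h0, h1, h2, h3⟩ := kerr_facts hM ha haM
  obtain ⟨s1, s2, s3⟩ := sturm_facts hM ha haM m hu hc hs
  rw [L2.inner_def, integral_congr_ae (g := fun x => (starRingEnd ℂ) (y x) * radialOp M a m v x),
    radial_integral hM ha haM, ← setIntegral_eq_integral_of_forall_compl_eq_zero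
      (s := Set.Ioi (rPlus M a)) (μ := volume)
      (f := fun x => (starRingEnd ℂ) (y x) * sturm M a m v x)]
  · apply setIntegral_congr_fun measurableSet_Ioi
    intro x hx
    have e1 : (kerrDelta M a x : ℂ) ≠ 0 := by exact_mod_cast (h1 x hx).ne'
    have e2 : (x : ℂ) ≠ 0 := by exact_mod_cast (h0.trans hx).ne'
    simp only [radialOp, sturm]
    push_cast
    field_simp
  · intro x hx
    rw [image_eq_zero_of_notMem_tsupport (f := sturm M a m v) fun h => hx (s3 h), mul_zero]
  · filter_upwards [hY, hG] with x hx1 hx2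
    rw [hx1, hx2, RCLike.inner_apply, mul_comm]

theorem inner_fn {M a : ℝ} (hM : 0 < M) (ha : 0 ≤ a) (haM : a ≤ M) {v y : ℝ → ℂ}
    (hs : tsupport v ⊆ Set.Ioi (rPlus M a))
    {Y G : Lp ℂ 2 (radialMeasure M a)} (hY : (Y : ℝ → ℂ) =ᵐ[radialMeasure M a] y)
    (hG : (G : ℝ → ℂ) =ᵐ[radialMeasure M a] v) :
    inner ℂ Y G =
      ∫ x, (starRingEnd ℂ) (y x) * (((x ^ 4 / kerrDelta M a x : ℝ) : ℂ) * v x) := by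
  rw [L2.inner_def, integral_congr_ae (g := fun x => (starRingEnd ℂ) (y x) * v x),
    radial_integral hM ha haM, ← setIntegral_eq_integral_of_forall_compl_eq_zero
      (s := Set.Ioi (rPlus M a)) (μ := volume)
      (f := fun x => (starRingEnd ℂ) (y x) * (((x ^ 4 / kerrDelta M a x : ℝ) : ℂ) * v x))]
  · apply setIntegral_congr_fun measurableSet_Ioi
    intro x hx
    simp only
    ring
  · intro x hx
    rw [image_eq_zero_of_notMem_tsupport (f := v) fun h => hx (hs h), mul_zero, mul_zero]
  · filter_upwards [hY, hG] with x hx1 hx2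
    rw [hx1, hx2, RCLike.inner_apply, mul_comm]

theorem cs_star {u : ℝ → ℂ} : tsupport (fun x => (starRingEnd ℂ) (u x)) = tsupport u := by
  unfold tsupport
  congr 1
  ext x
  simp

theorem form_int {M a : ℝ} (hM : 0 < M) (ha : 0 ≤ a) (haM : a ≤ M) (m : ℤ) {u v : ℝ → ℂ}
    (hu : ContDiff ℝ 2 u) (huc : HasCompactSupport u) (hus : tsupport u ⊆ Set.Ioi (rPlus M a))
    (hv : ContDiff ℝ 2 v) (hvc : HasCompactSupport v) (hvs : tsupport v ⊆ Set.Ioi (rPlus M a)) :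
    Integrable (fun x => (starRingEnd ℂ) (deriv u x) * ((kerrDelta M a x : ℂ) * deriv v x)) ∧
    Integrable (fun x => (starRingEnd ℂ) (u x) *
      ((((m : ℝ) ^ 2 * a ^ 2 / kerrDelta M a x : ℝ) : ℂ) * v x)) := by
  obtain ⟨u1, u2, u3, u4, u5, u6, u7, u8⟩ := flux_facts hu huc hus
  obtain ⟨f1, f2, f3, f4, f5, f6, f7, f8⟩ := flux_facts hv hvc hvs
  constructor
  · apply Continuous.integrable_of_hasCompactSupport
    · exact (Complex.continuous_conj.comp u1).mul f4.continuous
    · exact f5.mul_left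
  · apply Continuous.integrable_of_hasCompactSupport
    · apply (Complex.continuous_conj.comp hu.continuous).mul
      exact cont_mul_cs (Complex.continuous_ofReal.comp_continuousOn (kerr_inv_cont hM ha haM _))
        hv.continuous hvs
    · exact HasCompactSupport.mul_left (HasCompactSupport.mul_left hvc)

theorem form_eq {M a : ℝ} (hM : 0 < M) (ha : 0 ≤ a) (haM : a ≤ M) (m : ℤ) {u v : ℝ → ℂ}
    (hu : ContDiff ℝ 2 u) (huc : HasCompactSupport u) (hus : tsupport u ⊆ Set.Ioi (rPlus M a))
    (hv : ContDiff ℝ 2 v) (hvc : HasCompactSupport v) (hvs : tsupport v ⊆ Set.Ioi (rPlus M a)) :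
    ∫ x, (starRingEnd ℂ) (u x) * sturm M a m v x =
      ∫ x, ((starRingEnd ℂ) (deriv u x) * ((kerrDelta M a x : ℂ) * deriv v x) -
        (starRingEnd ℂ) (u x) * ((((m : ℝ) ^ 2 * a ^ 2 / kerrDelta M a x : ℝ) : ℂ) * v x)) := by
  obtain ⟨u1, u2, u3, u4, u5, u6, u7, u8⟩ := flux_facts hu huc hus
  obtain ⟨f1, f2, f3, f4, f5, f6, f7, f8⟩ := flux_facts hv hvc hvs
  obtain ⟨i1, i2⟩ := form_int hM ha haM m hu huc hus hv hvc hvs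
  have i3 : Integrable (fun x => (starRingEnd ℂ) (u x) *
      deriv (fun x => ((kerrDelta M a x : ℝ) : ℂ) * deriv v x) x) :=
    ((Complex.continuous_conj.comp hu.continuous).mul f6).integrable_of_hasCompactSupport
      f7.mul_left
  have i4 : Integrable (fun x => (starRingEnd ℂ) (u x) *
      (((kerrDelta M a x : ℝ) : ℂ) * deriv v x)) :=
    ((Complex.continuous_conj.comp hu.continuous).mul f4.continuous).integrable_of_hasCompactSupport
      f5.mul_left
  have key : ∫ x, (starRingEnd ℂ) (u x) *
      deriv (fun x => ((kerrDelta M a x : ℝ) : ℂ) * deriv v x) x =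
      - ∫ x, (starRingEnd ℂ) (deriv u x) * ((kerrDelta M a x : ℂ) * deriv v x) := by
    apply integral_mul_deriv_eq_deriv_mul_of_integrable (A := ℂ)
    · intro x _
      exact ((hu.differentiable two_ne_zero x).hasDerivAt).star
    · intro x _
      exact (f4.differentiable one_ne_zero x).hasDerivAt
    · exact i3
    · exact i1
    · exact i4
  have i5 : Integrable (fun x => -((starRingEnd ℂ) (u x) *
      deriv (fun x => ((kerrDelta M a x : ℝ) : ℂ) * deriv v x) x)) := i3.neg
  rw [integral_sub i1 i2, ← neg_eq_iff_eq_neg.2 key, ← integral_neg, ← integral_sub i5 i2]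
  congr 1; ext x
  simp only [sturm]
  ring

theorem lp_zero {M a : ℝ} (Y : Lp ℂ 2 (radialMeasure M a))
    (h : ∀ᵐ x, x ∈ Set.Ioi (rPlus M a) → Y x = 0) : Y = 0 := by
  rw [Lp.eq_zero_iff_ae_eq_zero]
  exact radial_ae h

theorem wfun_facts {M a : ℝ} (hM : 0 < M) (ha : 0 ≤ a) (haM : a ≤ M) {v : ℝ → ℂ}
    (hv : Continuous v) (hc : HasCompactSupport v) (hs : tsupport v ⊆ Set.Ioi (rPlus M a)) :
    Continuous (fun x => ((x ^ 4 / kerrDelta M a x : ℝ) : ℂ) * v x) ∧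
    HasCompactSupport (fun x => ((x ^ 4 / kerrDelta M a x : ℝ) : ℂ) * v x) ∧
    tsupport (fun x => ((x ^ 4 / kerrDelta M a x : ℝ) : ℂ) * v x) ⊆ Set.Ioi (rPlus M a) :=
  ⟨cont_mul_cs (Complex.continuous_ofReal.comp_continuousOn (weight_cont hM ha haM)) hv hs,
    hc.mul_left, tsupport_mul_subset_right.trans hs⟩

theorem conj_locint {c : ℝ} {y : ℝ → ℂ} (hy : LocallyIntegrableOn y (Set.Ioi c)) :
    LocallyIntegrableOn (fun x => (starRingEnd ℂ) (y x)) (Set.Ioi c) := by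
  intro x hx
  obtain ⟨s, hs, h⟩ := hy x hx
  exact ⟨s, hs, Complex.conjCLE.toContinuousLinearMap.integrable_comp h⟩

theorem re_locint {c : ℝ} {y : ℝ → ℂ} (hy : LocallyIntegrableOn y (Set.Ioi c)) (L : ℂ →L[ℝ] ℝ) :
    LocallyIntegrableOn (fun x => L (y x)) (Set.Ioi c) := by
  intro x hx
  obtain ⟨s, hs, h⟩ := hy x hx
  exact ⟨s, hs, L.integrable_comp h⟩

theorem deriv_ofReal {φ : ℝ → ℝ} (h : Differentiable ℝ φ) :
    deriv (fun x => (φ x : ℂ)) = fun x => ((deriv φ x : ℝ) : ℂ) := by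
  ext x
  exact ((h x).hasDerivAt.ofReal_comp).deriv

theorem sturm_ofReal {M a : ℝ} (m : ℤ) {φ : ℝ → ℝ} (hφ : ContDiff ℝ 2 φ) (x : ℝ) :
    sturm M a m (fun x => (φ x : ℂ)) x =
      ((-deriv (fun y => kerrDelta M a y * deriv φ y) x -
        (m : ℝ) ^ 2 * a ^ 2 / kerrDelta M a x * φ x : ℝ) : ℂ) := by
  have hd : ContDiff ℝ 1 (deriv φ) := by
    have : ContDiff ℝ (1 + 1) φ := by norm_num; exact hφ
    exact (contDiff_succ_iff_deriv.1 this).2.2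
  have h1 : Differentiable ℝ (fun y => kerrDelta M a y * deriv φ y) :=
    ((kerr_contDiff M a).mul hd).differentiable one_ne_zero
  have h2 := deriv_ofReal h1
  simp only [sturm]
  rw [deriv_ofReal (hφ.differentiable two_ne_zero)]
  have h3 : (fun x => ((kerrDelta M a x : ℝ) : ℂ) * ((deriv φ x : ℝ) : ℂ)) =
      fun x => ((kerrDelta M a x * deriv φ x : ℝ) : ℂ) := by
    ext x; push_cast; rfl
  rw [h3, h2]
  push_cast
  ring

theorem ofReal_tsupport (φ : ℝ → ℝ) : tsupport (fun x => (φ x : ℂ)) = tsupport φ := by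
  unfold tsupport
  congr 1
  ext x
  simp

theorem ofReal_test {c : ℝ} {φ : ℝ → ℝ} {n : WithTop ℕ∞} (h1 : ContDiff ℝ n φ)
    (h2 : HasCompactSupport φ)
    (h3 : tsupport φ ⊆ Set.Ioi c) : ContDiff ℝ n (fun x => (φ x : ℂ)) ∧
      HasCompactSupport (fun x => (φ x : ℂ)) ∧ tsupport (fun x => (φ x : ℂ)) ⊆ Set.Ioi c := by
  refine ⟨Complex.ofRealCLM.contDiff.comp h1, ?_, ?_⟩
  · rw [HasCompactSupport, ofReal_tsupport]; exact h2
  · rw [ofReal_tsupport]; exact h3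

theorem real_kernel {M a : ℝ} (hM : 0 < M) (ha : 0 ≤ a) (haM : a ≤ M) (m : ℤ)
    (Y : Lp ℂ 2 (radialMeasure M a)) (L : ℂ →L[ℝ] ℝ) (hL : ∀ z, |L z| ≤ ‖z‖)
    (h : ∀ φ : ℝ → ℝ, ContDiff ℝ 2 φ → HasCompactSupport φ → tsupport φ ⊆ Set.Ioi (rPlus M a) →
      ∫ x, L (Y x) * (deriv (fun y => kerrDelta M a y * deriv φ y) x -
        (((m : ℝ) ^ 2 * a ^ 2 / rPlus M a ^ 4 + 1) * (x ^ 4 / kerrDelta M a x) -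
        (m : ℝ) ^ 2 * a ^ 2 / kerrDelta M a x) * φ x) = 0) :
    ∀ᵐ x, x ∈ Set.Ioi (rPlus M a) → L (Y x) = 0 := by
  obtain ⟨h0, h1, h2, h3⟩ := kerr_facts hM ha haM
  have hQc : ContinuousOn (fun x => ((m : ℝ) ^ 2 * a ^ 2 / rPlus M a ^ 4 + 1) *
      (x ^ 4 / kerrDelta M a x) - (m : ℝ) ^ 2 * a ^ 2 / kerrDelta M a x)
      (Set.Ioi (rPlus M a)) :=
    (continuousOn_const.mul (weight_cont hM ha haM)).sub (kerr_inv_cont hM ha haM _)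
  obtain ⟨v, p, hae, hder⟩ := weak_reg (kerr_contDiff M a) h1 hQc
    (re_locint (radial_locint hM ha haM Y) L) h
  have hv0 : ∀ x, rPlus M a < x → v x = 0 := by
    apply sol_zero h1 _ (fun x hx => (hder x hx).1) (fun x hx => (hder x hx).2) _
      (weight_meas M a) _ (fun r hr => weight_not_left hM ha haM hr)
      (fun r hr => weight_not_right hM ha haM hr)
    · intro x hx
      have e1 := h1 x hx
      have e2 : (m : ℝ) ^ 2 * a ^ 2 ≤ ((m : ℝ) ^ 2 * a ^ 2 / rPlus M a ^ 4 + 1) * x ^ 4 := by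
        have e3 : rPlus M a ^ 4 ≤ x ^ 4 := by gcongr
        have e4 : (m : ℝ) ^ 2 * a ^ 2 = (m : ℝ) ^ 2 * a ^ 2 / rPlus M a ^ 4 * rPlus M a ^ 4 := by
          field_simp
        have e5 : (m : ℝ) ^ 2 * a ^ 2 / rPlus M a ^ 4 * rPlus M a ^ 4 ≤
          (m : ℝ) ^ 2 * a ^ 2 / rPlus M a ^ 4 * x ^ 4 := by gcongr
        have e6 : 0 ≤ x ^ 4 := by positivity
        linarith
      rw [← mul_div_assoc, ← sub_div]
      exact div_nonneg (sub_nonneg.2 e2) e1.le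
    · intro x hx
      exact le_trans (by positivity) (weight_lb hM ha haM hx)
    · have i1 : IntegrableOn (fun x => L (Y x) ^ 2 * (x ^ 4 / kerrDelta M a x))
          (Set.Ioi (rPlus M a)) := by
        apply Integrable.mono' (radial_lp_sq hM ha haM Y)
        · exact (((L.continuous.comp_stronglyMeasurable (Lp.stronglyMeasurable Y)).pow 2).mul
            (weight_meas M a).stronglyMeasurable).aestronglyMeasurable
        filter_upwards [ae_restrict_mem measurableSet_Ioi] with x hx
        have e1 : 0 ≤ x ^ 4 / kerrDelta M a x :=
          le_trans (by positivity) (weight_lb hM ha haM hx)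
        rw [Real.norm_of_nonneg (by positivity), mul_comm]
        apply mul_le_mul_of_nonneg_left _ e1
        rw [← sq_abs]
        have := hL (Y x)
        gcongr
      apply i1.congr
      filter_upwards [(ae_restrict_iff' measurableSet_Ioi).2 hae] with x hx
      rw [hx]
  filter_upwards [hae] with x hx hxI
  rw [hx hxI, hv0 x hxI]

theorem kernel_zero {M a : ℝ} (hM : 0 < M) (ha : 0 ≤ a) (haM : a ≤ M) (m : ℤ)
    (Y : Lp ℂ 2 (radialMeasure M a))
    (h : ∀ u : ℝ → ℂ, ContDiff ℝ 2 u → HasCompactSupport u → tsupport u ⊆ Set.Ioi (rPlus M a) →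
      (∫ x, (starRingEnd ℂ) (Y x) * sturm M a m u x) +
        (((m : ℝ) ^ 2 * a ^ 2 / rPlus M a ^ 4 + 1 : ℝ) : ℂ) *
        ∫ x, (starRingEnd ℂ) (Y x) * (((x ^ 4 / kerrDelta M a x : ℝ) : ℂ) * u x) = 0) : Y = 0 := by
  have hloc := conj_locint (radial_locint hM ha haM Y)
  have key : ∀ φ : ℝ → ℝ, ContDiff ℝ 2 φ → HasCompactSupport φ →
      tsupport φ ⊆ Set.Ioi (rPlus M a) → ∀ L : ℂ →L[ℝ] ℝ,
      ∫ x, L ((starRingEnd ℂ) (Y x)) * (deriv (fun y => kerrDelta M a y * deriv φ y) x -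
        (((m : ℝ) ^ 2 * a ^ 2 / rPlus M a ^ 4 + 1) * (x ^ 4 / kerrDelta M a x) -
        (m : ℝ) ^ 2 * a ^ 2 / kerrDelta M a x) * φ x) = 0 := by
    intro φ p1 p2 p3 L
    obtain ⟨q1, q2, q3⟩ := ofReal_test p1 p2 p3
    obtain ⟨s1, s2, s3⟩ := sturm_facts hM ha haM m q1 q2 q3
    obtain ⟨w1, w2, w3⟩ := wfun_facts hM ha haM q1.continuous q2 q3
    have i1 := locint_mul_cs hloc s1 s2 s3
    have i2 := (locint_mul_cs hloc w1 w2 w3).const_mul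
      (((m : ℝ) ^ 2 * a ^ 2 / rPlus M a ^ 4 + 1 : ℝ) : ℂ)
    have h1 := h _ q1 q2 q3
    rw [← integral_const_mul, ← integral_add i1 i2] at h1
    have h2 := L.integral_comp_comm (i1.add i2)
    simp only [Pi.add_apply] at h2
    rw [h1, map_zero] at h2
    rw [← neg_eq_zero, ← integral_neg, ← h2]
    congr 1; ext x
    rw [sturm_ofReal m p1]
    have : ∀ (z : ℂ) (t s r : ℝ), z * (t : ℂ) + (s : ℂ) * (z * ((r : ℂ) * (φ x : ℂ))) =
        (t + s * (r * φ x)) • z := by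
      intro z t s r
      rw [Complex.real_smul]; push_cast; ring
    rw [this, map_smul, smul_eq_mul]
    ring
  apply lp_zero
  have hre := real_kernel hM ha haM m Y Complex.reCLM Complex.abs_re_le_norm (by
    intro φ p1 p2 p3
    have := key φ p1 p2 p3 Complex.reCLM
    simpa using this)
  have him := real_kernel hM ha haM m Y Complex.imCLM Complex.abs_im_le_norm (by
    intro φ p1 p2 p3
    have := key φ p1 p2 p3 (-Complex.imCLM)
    simpa using this)
  filter_upwards [hre, him] with x h1 h2 hx
  exact Complex.ext (h1 hx) (h2 hx)

theorem dense_zero {M a : ℝ} (hM : 0 < M) (ha : 0 ≤ a) (haM : a ≤ M)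
    (Y : Lp ℂ 2 (radialMeasure M a))
    (h : ∀ u : ℝ → ℂ, ContDiff ℝ 2 u → HasCompactSupport u → tsupport u ⊆ Set.Ioi (rPlus M a) →
      ∫ x, (starRingEnd ℂ) (Y x) * (((x ^ 4 / kerrDelta M a x : ℝ) : ℂ) * u x) = 0) : Y = 0 := by
  obtain ⟨h0, h1, h2, h3⟩ := kerr_facts hM ha haM
  have hloc := (conj_locint (radial_locint hM ha haM Y)).mul_continuousOn
    (Complex.continuous_ofReal.comp_continuousOn (weight_cont hM ha haM))
    isOpen_Ioi.isLocallyClosed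
  apply lp_zero
  have := isOpen_Ioi.ae_eq_zero_of_integral_contDiff_smul_eq_zero hloc (by
    intro φ p1 p2 p3
    have p1' : ContDiff ℝ 2 φ := by exact_mod_cast contDiff_infty.1 p1 2
    obtain ⟨q1, q2, q3⟩ := ofReal_test p1' p2 p3
    rw [← h _ q1 q2 q3]
    congr 1; ext x
    rw [Complex.real_smul]
    simp only [Function.comp]
    ring)
  filter_upwards [this] with x hx hxI
  have h4 := hx hxI
  have h5 : ((x ^ 4 / kerrDelta M a x : ℝ) : ℂ) ≠ 0 := by
    have e1 : 0 < x := h0.trans hxI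
    have e2 := h1 x hxI
    have : x ^ 4 / kerrDelta M a x ≠ 0 := by positivity
    exact_mod_cast this
  rcases mul_eq_zero.1 h4 with h6 | h6
  · simpa using h6
  · exact absurd h6 h5

theorem stmt_7 (M a : ℝ) (m : ℤ) (hM : 0 < M) (ha : 0 ≤ a) (haM : a ≤ M)
    (T : Lp ℂ 2 (radialMeasure M a) →ₗ.[ℂ] Lp ℂ 2 (radialMeasure M a))
    (hdom : ∀ F : Lp ℂ 2 (radialMeasure M a),
      F ∈ T.domain ↔ ∃ u : ℝ → ℂ, ContDiff ℝ 2 u ∧ HasCompactSupport u ∧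
        tsupport u ⊆ Set.Ioi (rPlus M a) ∧ (F : ℝ → ℂ) =ᵐ[radialMeasure M a] u)
    (hval : ∀ (F : T.domain) (u : ℝ → ℂ), ContDiff ℝ 2 u → HasCompactSupport u →
      tsupport u ⊆ Set.Ioi (rPlus M a) →
      ((F : Lp ℂ 2 (radialMeasure M a)) : ℝ → ℂ) =ᵐ[radialMeasure M a] u →
      (T F : ℝ → ℂ) =ᵐ[radialMeasure M a] radialOp M a m u) :
    T.adjoint = T.closure := by
  obtain ⟨h0, h1, h2, h3⟩ := kerr_facts hM ha haM
  have hmk : ∀ u : ℝ → ℂ, ContDiff ℝ 2 u → HasCompactSupport u →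
      tsupport u ⊆ Set.Ioi (rPlus M a) → ∃ F : T.domain,
      ((F : Lp ℂ 2 (radialMeasure M a)) : ℝ → ℂ) =ᵐ[radialMeasure M a] u := by
    intro u u1 u2 u3
    have hmem := radial_memLp hM ha haM u1.continuous u2 u3
    exact ⟨⟨hmem.toLp u, (hdom _).2 ⟨u, u1, u2, u3, hmem.coeFn_toLp⟩⟩, hmem.coeFn_toLp⟩
  apply esa_of_lower_bound T _ _ ((m : ℝ) ^ 2 * a ^ 2 / rPlus M a ^ 4 + 1)
  · -- lower bound
    intro F
    obtain ⟨u, u1, u2, u3, hu⟩ := (hdom F).1 F.2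
    have hTF := hval F u u1 u2 u3 hu
    have e1 := inner_op hM ha haM m u1 u2 u3 hu hTF
    rw [form_eq hM ha haM m u1 u2 u3 u1 u2 u3] at e1
    have e2 := inner_fn hM ha haM u3 hu hu
    obtain ⟨i1, i2⟩ := form_int hM ha haM m u1 u2 u3 u1 u2 u3
    have i3 : Integrable (fun x => (starRingEnd ℂ) (u x) *
        (((x ^ 4 / kerrDelta M a x : ℝ) : ℂ) * u x)) := by
      obtain ⟨w1, w2, w3⟩ := wfun_facts hM ha haM u1.continuous u2 u3
      exact ((Complex.continuous_conj.comp u1.continuous).mul w1).integrable_of_hasCompactSupport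
        w2.mul_left
    set k : ℝ := (m : ℝ) ^ 2 * a ^ 2 / rPlus M a ^ 4 with hk
    have e3 : inner ℂ (F : Lp ℂ 2 (radialMeasure M a))
        (T F + ((k + 1 : ℝ) : ℂ) • (F : Lp ℂ 2 (radialMeasure M a))) -
        inner ℂ (F : Lp ℂ 2 (radialMeasure M a)) (F : Lp ℂ 2 (radialMeasure M a)) =
        ((∫ x, (kerrDelta M a x * ‖deriv u x‖ ^ 2 + (k * (x ^ 4 / kerrDelta M a x) -
          (m : ℝ) ^ 2 * a ^ 2 / kerrDelta M a x) * ‖u x‖ ^ 2) : ℝ) : ℂ) := by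
      rw [inner_add_right, inner_smul_right, ← integral_complex_ofReal]
      have : ∀ A B : ℂ, A + ((k + 1 : ℝ) : ℂ) * B - B = A + (k : ℂ) * B := by
        intro A B; push_cast; ring
      have i4 : Integrable (fun x => (starRingEnd ℂ) (deriv u x) *
          ((kerrDelta M a x : ℂ) * deriv u x) - (starRingEnd ℂ) (u x) *
          ((((m : ℝ) ^ 2 * a ^ 2 / kerrDelta M a x : ℝ) : ℂ) * u x)) := i1.sub i2
      rw [this, e1, e2, ← integral_const_mul, ← integral_add i4 (i3.const_mul _)]
      congr 1; ext x
      have c1 := Complex.conj_mul' (deriv u x)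
      have c2 := Complex.conj_mul' (u x)
      push_cast
      rw [← c1, ← c2]
      ring
    have e4 : 0 ≤ ∫ x, (kerrDelta M a x * ‖deriv u x‖ ^ 2 + (k * (x ^ 4 / kerrDelta M a x) -
          (m : ℝ) ^ 2 * a ^ 2 / kerrDelta M a x) * ‖u x‖ ^ 2) := by
      apply integral_nonneg
      intro x
      simp only [Pi.zero_apply]
      by_cases hx : rPlus M a < x
      · have d1 := h1 x hx
        have d2 : 0 ≤ k * (x ^ 4 / kerrDelta M a x) - (m : ℝ) ^ 2 * a ^ 2 / kerrDelta M a x := by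
          rw [← mul_div_assoc, ← sub_div]
          apply div_nonneg _ d1.le
          have d3 : rPlus M a ^ 4 ≤ x ^ 4 := by gcongr
          have d4 : (m : ℝ) ^ 2 * a ^ 2 = k * rPlus M a ^ 4 := by
            rw [hk]; field_simp
          have d5 : 0 ≤ k := by rw [hk]; positivity
          rw [d4, ← mul_sub]
          exact mul_nonneg d5 (sub_nonneg.2 d3)
        positivity
      · have d1 : u x = 0 := image_eq_zero_of_notMem_tsupport fun h => hx (u3 h)
        have d2 : deriv u x = 0 := by
          by_contra h
          exact hx (u3 (support_deriv_subset h))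
        simp [d1, d2]
    have e5 := congrArg Complex.re e3
    rw [Complex.sub_re, Complex.ofReal_re] at e5
    have e6 : (inner ℂ (F : Lp ℂ 2 (radialMeasure M a))
      (F : Lp ℂ 2 (radialMeasure M a))).re = ‖(F : Lp ℂ 2 (radialMeasure M a))‖ ^ 2 := by
      rw [inner_self_eq_norm_sq_to_K]
      norm_cast
    have e7 := (Complex.re_le_norm _).trans (norm_inner_le_norm (𝕜 := ℂ)
      (F : Lp ℂ 2 (radialMeasure M a))
        (T F + ((k + 1 : ℝ) : ℂ) • (F : Lp ℂ 2 (radialMeasure M a))))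
    rcases (norm_nonneg (F : Lp ℂ 2 (radialMeasure M a))).eq_or_lt with h | h
    · rw [← h]; exact norm_nonneg _
    · nlinarith
  · -- kernel
    intro Y hY
    apply kernel_zero hM ha haM m Y
    intro u u1 u2 u3
    obtain ⟨F, hF⟩ := hmk u u1 u2 u3
    have := hY F
    rwa [inner_add_right, inner_smul_right,
      inner_op hM ha haM m u1 u2 u3 (Filter.EventuallyEq.refl _ _) (hval F u u1 u2 u3 hF),
      inner_fn hM ha haM u3 (Filter.EventuallyEq.refl _ _) hF] at this
  · -- density
    rw [Submodule.dense_iff_topologicalClosure_eq_top, Submodule.topologicalClosure_eq_top_iff,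
      Submodule.eq_bot_iff]
    intro Y hY
    rw [Submodule.mem_orthogonal'] at hY
    apply dense_zero hM ha haM Y
    intro u u1 u2 u3
    obtain ⟨F, hF⟩ := hmk u u1 u2 u3
    rw [← inner_fn hM ha haM u3 (Filter.EventuallyEq.refl _ _) hF]
    exact hY F F.2
  · -- symmetry
    intro F G
    obtain ⟨u, u1, u2, u3, hu⟩ := (hdom F).1 F.2
    obtain ⟨v, v1, v2, v3, hv⟩ := (hdom G).1 G.2
    have hTF := hval F u u1 u2 u3 hu
    have hTG := hval G v v1 v2 v3 hv
    rw [← inner_conj_symm, inner_op hM ha haM m u1 u2 u3 hv hTF,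
      inner_op hM ha haM m v1 v2 v3 hu hTG, form_eq hM ha haM m v1 v2 v3 u1 u2 u3,
      form_eq hM ha haM m u1 u2 u3 v1 v2 v3, ← integral_conj]
    congr 1; ext x
    simp only [map_sub, map_mul, Complex.conj_conj, Complex.conj_ofReal]
    ring
end

section
/- Let n ≥ 1, a ∈ ℝ, I := [a,∞), I₀ := (a,∞). Let A₀ be a diagonalizable complex n×n matrix, let e′₁,…,e′ₙ be a basis of ℂⁿ of eigenvectors of A₀ with A₀e′ⱼ = λⱼe′ⱼ, and for each j let Pⱼ be the matrix of the projection of ℂⁿ onto ℂ·e′ⱼ along the span of the remaining basis vectors (so P₁+⋯+Pₙ = E, the identity matrix, and PⱼPₖ = δⱼₖPⱼ). Let A₁ : I → M(n×n,ℂ) be continuous with every entry Lebesgue integrable on I. Then there exists a continuously differentiable map R : I₀ → M(n×n,ℂ) with limₜ→∞ Rⱼₖ(t) = 0 for all j,k, such that u : I₀ → M(n×n,ℂ) defined by u(t) := Σⱼ₌₁ⁿ exp(λⱼt) · (E + R(t)) · Pⱼ takes values in the invertible n×n matrices and satisfies u′(t) = (A₀ + A₁(t)) · u(t) for all t ∈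 I₀. -/
open MeasureTheory Filter

/-- The candidate fundamental matrix `u(t) = Σⱼ exp(λⱼt)·(E + R(t))·Pⱼ`. -/
noncomputable def uSol (n : ℕ) (lam : Fin n → ℂ) (R : ℝ → Matrix (Fin n) (Fin n) ℂ)
    (P : Fin n → Matrix (Fin n) (Fin n) ℂ) (t : ℝ) : Matrix (Fin n) (Fin n) ℂ :=
  ∑ j, Complex.exp (lam j * t) • ((1 + R t) * P j)

section LevinsonAux
open Set Topology

noncomputable def Gop (μ : ℂ) (T : ℝ) (h : ℝ → ℂ) (t : ℝ) : ℂ :=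
  if 0 ≤ μ.re then -∫ s in Ioi t, Complex.exp (μ * (t - s)) * h s
  else ∫ s in T..t, Complex.exp (μ * (t - s)) * h s

lemma kint (μ : ℂ) (t : ℝ) {h : ℝ → ℂ} (hh : Integrable h) (a b : ℝ) :
    IntervalIntegrable (fun s : ℝ => Complex.exp (μ * (t - s)) * h s) volume a b := by
  apply IntervalIntegrable.continuousOn_mul hh.intervalIntegrable
  fun_prop

lemma kint' {μ : ℂ} (hμ : 0 ≤ μ.re) (t r : ℝ) {h : ℝ → ℂ} (hh : Integrable h) :
    IntegrableOn (fun s : ℝ => Complex.exp (μ * (t - s)) * h s) (Ioi r) := by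
  apply Integrable.bdd_mul (c := Real.exp (μ.re * (t - r))) hh.integrableOn
  · exact Continuous.aestronglyMeasurable (by fun_prop)
  · filter_upwards [ae_restrict_mem measurableSet_Ioi] with s hs
    rw [Complex.norm_exp]
    simp only [Complex.mul_re, Complex.sub_re, Complex.ofReal_re, Complex.sub_im,
      Complex.ofReal_im, sub_zero, mul_zero]
    gcongr
    exact le_of_lt hs

/-- closed form of `Gop`. -/
lemma Gop_eq (μ : ℂ) (T : ℝ) {h : ℝ → ℂ} (hh : Integrable h) :
    ∃ c : ℂ, ∀ t : ℝ, Gop μ T h t =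
      Complex.exp (μ * t) * ((∫ s in T..t, Complex.exp (μ * ((0:ℝ) - s)) * h s) - c) := by
  have e : ∀ t s : ℝ, Complex.exp (μ * (t - s)) * h s
      = Complex.exp (μ * t) * (Complex.exp (μ * ((0:ℝ) - s)) * h s) := by
    intro t s
    rw [← mul_assoc, ← Complex.exp_add]
    congr 2
    push_cast; ring
  by_cases hμ : 0 ≤ μ.re
  · refine ⟨∫ s in Ioi T, Complex.exp (μ * ((0:ℝ) - s)) * h s, fun t => ?_⟩
    simp only [Gop, hμ, if_true]
    rw [← intervalIntegral.integral_interval_add_Ioi (kint' hμ 0 T hh) (kint' hμ 0 t hh)]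
    simp_rw [e t]
    rw [integral_const_mul]
    ring
  · refine ⟨0, fun t => ?_⟩
    simp only [Gop, hμ, if_false, sub_zero]
    simp_rw [e t]
    rw [intervalIntegral.integral_const_mul]

lemma Gop_cont (μ : ℂ) (T : ℝ) {h : ℝ → ℂ} (hh : Integrable h) : Continuous (Gop μ T h) := by
  obtain ⟨c, hc⟩ := Gop_eq μ T hh
  rw [show Gop μ T h = _ from funext hc]
  have := intervalIntegral.continuous_primitive (fun a b => kint μ 0 hh a b) T
  fun_prop

lemma Gop_deriv (μ : ℂ) (T : ℝ) {h : ℝ → ℂ} (hh : Integrable h) {t : ℝ} (ht : ContinuousAt h t) :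
    HasDerivAt (Gop μ T h) (μ * Gop μ T h t + h t) t := by
  obtain ⟨c, hc⟩ := Gop_eq μ T hh
  rw [show Gop μ T h = _ from funext hc]
  have h1 : HasDerivAt (fun u : ℝ => ∫ s in T..u, Complex.exp (μ * ((0:ℝ) - s)) * h s)
      (Complex.exp (μ * ((0:ℝ) - t)) * h t) t := by
    apply intervalIntegral.integral_hasDerivAt_right (kint μ 0 hh T t)
    · refine ⟨univ, univ_mem, ?_⟩
      apply AEStronglyMeasurable.mul
      · exact Continuous.aestronglyMeasurable (by fun_prop)
      · simpa using hh.aestronglyMeasurable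
    · apply ContinuousAt.mul _ ht
      fun_prop
  have h2 : HasDerivAt (fun u : ℝ => Complex.exp (μ * u)) (Complex.exp (μ * t) * (μ * 1)) t :=
    ((Complex.ofRealCLM.hasDerivAt (x := t)).const_mul μ).cexp
  refine (h2.mul (h1.sub_const c)).congr_deriv ?_
  have : Complex.exp (μ * t) * (Complex.exp (μ * ((0:ℝ) - t)) * h t) = h t := by
    rw [← mul_assoc, ← Complex.exp_add]
    simp
  simp only [mul_one]
  linear_combination this

lemma Gop_sub (μ : ℂ) (T : ℝ) {h k : ℝ → ℂ} (hh : Integrable h) (hk : Integrable k) (t : ℝ) :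
    Gop μ T h t - Gop μ T k t = Gop μ T (fun s => h s - k s) t := by
  unfold Gop
  split_ifs with hμ
  · simp_rw [mul_sub (Complex.exp _)]
    rw [integral_sub (kint' hμ t t hh) (kint' hμ t t hk)]
    ring
  · simp_rw [mul_sub (Complex.exp _)]
    rw [intervalIntegral.integral_sub (kint μ t hh _ _) (kint μ t hk _ _)]

lemma nexp (μ : ℂ) (t s : ℝ) : ‖Complex.exp (μ * (t - s))‖ = Real.exp (μ.re * (t - s)) := by
  rw [Complex.norm_exp]; simp

lemma Gop_bd1 {μ : ℂ} (hμ : 0 ≤ μ.re) (T : ℝ) {h : ℝ → ℂ} (hh : Integrable h) (t : ℝ) :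
    ‖Gop μ T h t‖ ≤ ∫ s in Ioi t, ‖h s‖ := by
  simp only [Gop, hμ, if_true, norm_neg]
  apply norm_integral_le_of_norm_le hh.norm.integrableOn
  filter_upwards [ae_restrict_mem measurableSet_Ioi] with s hs
  rw [norm_mul, nexp]
  apply mul_le_of_le_one_left (norm_nonneg _)
  rw [Real.exp_le_one_iff]
  exact mul_nonpos_of_nonneg_of_nonpos hμ (by linarith [mem_Ioi.1 hs])

lemma Gop_bd2 {μ : ℂ} (hμ : ¬ 0 ≤ μ.re) {T : ℝ} {h : ℝ → ℂ} (hh : Integrable h) {t : ℝ}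
    (ht : T ≤ t) :
    ‖Gop μ T h t‖ ≤ ∫ s in T..t, ‖h s‖ := by
  simp only [Gop, hμ, if_false]
  apply intervalIntegral.norm_integral_le_of_norm_le ht _ hh.norm.intervalIntegrable
  refine Eventually.of_forall fun s hs => ?_
  rw [norm_mul, nexp]
  apply mul_le_of_le_one_left (norm_nonneg _)
  rw [Real.exp_le_one_iff]
  exact mul_nonpos_of_nonpos_of_nonneg (by linarith) (by linarith [hs.2])

lemma Gop_bd3 {μ : ℂ} (hμ : ¬ 0 ≤ μ.re) {a T : ℝ} {h : ℝ → ℂ} (hh : Integrable h) {t : ℝ}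
    (hat : a ≤ t) (ht : t ≤ T) {C : ℝ} (hC : ‖μ‖ ≤ C) :
    ‖Gop μ T h t‖ ≤ Real.exp (C * (T - a)) * ∫ s in t..T, ‖h s‖ := by
  simp only [Gop, hμ, if_false]
  rw [intervalIntegral.integral_symm, norm_neg, ← intervalIntegral.integral_const_mul]
  apply intervalIntegral.norm_integral_le_of_norm_le ht _
    (hh.norm.intervalIntegrable.const_mul _)
  refine Eventually.of_forall fun s hs => ?_
  rw [norm_mul, nexp]
  apply mul_le_mul_of_nonneg_right _ (norm_nonneg _)
  apply Real.exp_le_exp.2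
  have h1 : -μ.re ≤ C := by
    have := Complex.abs_re_le_norm μ
    have := neg_abs_le μ.re
    linarith
  have h2 : μ.re * (t - s) = (-μ.re) * (s - t) := by ring
  rw [h2]
  have := hs.1
  have := hs.2
  apply mul_le_mul h1 <;> linarith [norm_nonneg μ]

lemma Gop_bdT (μ : ℂ) {T : ℝ} {h : ℝ → ℂ} (hh : Integrable h) {t : ℝ} (ht : T ≤ t) :
    ‖Gop μ T h t‖ ≤ ∫ s in Ioi T, ‖h s‖ := by
  by_cases hμ : 0 ≤ μ.re
  · refine (Gop_bd1 hμ T hh t).trans ?_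
    apply setIntegral_mono_set hh.norm.integrableOn (Eventually.of_forall fun _ => norm_nonneg _)
    exact (Ioi_subset_Ioi ht).eventuallyLE
  · refine (Gop_bd2 hμ hh ht).trans ?_
    rw [intervalIntegral.integral_of_le ht]
    apply setIntegral_mono_set hh.norm.integrableOn (Eventually.of_forall fun _ => norm_nonneg _)
    exact Ioc_subset_Ioi_self.eventuallyLE

lemma Gop_bda (μ : ℂ) {a T : ℝ} {h : ℝ → ℂ} (hh : Integrable h) {t : ℝ}
    (hat : a ≤ t) (ht : t ≤ T) {C : ℝ} (hC : ‖μ‖ ≤ C) :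
    ‖Gop μ T h t‖ ≤ Real.exp (C * (T - a)) * (∫ s in t..T, ‖h s‖) + ∫ s in Ioi T, ‖h s‖ := by
  have p2 : 0 ≤ ∫ s in Ioi T, ‖h s‖ := integral_nonneg fun _ => norm_nonneg _
  by_cases hμ : 0 ≤ μ.re
  · refine (Gop_bd1 hμ T hh t).trans ?_
    rw [← intervalIntegral.integral_interval_add_Ioi hh.norm.integrableOn
      (hh.norm.integrableOn (s := Ioi T))]
    gcongr
    apply le_mul_of_one_le_left
    · exact intervalIntegral.integral_nonneg ht fun _ _ => norm_nonneg _
    · rw [Real.one_le_exp_iff]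
      have := norm_nonneg μ
      apply mul_nonneg <;> linarith
  · have := Gop_bd3 hμ hh hat ht hC
    linarith

lemma Gop_tendsto (μ : ℂ) (T : ℝ) {h : ℝ → ℂ} (hh : Integrable h) :
    Tendsto (Gop μ T h) atTop (𝓝 0) := by
  by_cases hμ : 0 ≤ μ.re
  · apply squeeze_zero_norm (Gop_bd1 hμ T hh)
    exact tendsto_integral_Ioi_zero tendsto_id
  · have key : Tendsto (fun t : ℝ => ∫ s, (Ioc T t).indicator
        (fun s : ℝ => Complex.exp (μ * (t - s)) * h s) s) atTop (𝓝 (∫ s : ℝ, (0:ℂ))) := by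
      apply tendsto_integral_filter_of_dominated_convergence (fun s => ‖h s‖) _ _ hh.norm
      · refine Eventually.of_forall fun s => ?_
        have : Tendsto (fun t : ℝ => Real.exp (μ.re * (t - s)) * ‖h s‖) atTop (𝓝 (0 * ‖h s‖)) := by
          apply Tendsto.mul_const
          apply Real.tendsto_exp_atBot.comp
          apply Tendsto.const_mul_atTop_of_neg (by linarith)
          exact tendsto_atTop_add_const_right _ _ tendsto_id
        rw [zero_mul] at this
        apply squeeze_zero_norm _ this
        intro t
        refine (norm_indicator_le_norm_self _ _).trans ?_
        rw [norm_mul, nexp]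
      · refine Eventually.of_forall fun t => ?_
        apply AEStronglyMeasurable.indicator _ measurableSet_Ioc
        apply AEStronglyMeasurable.mul _ hh.aestronglyMeasurable
        exact Continuous.aestronglyMeasurable (by fun_prop)
      · refine Eventually.of_forall fun t => Eventually.of_forall fun s => ?_
        by_cases hs : s ∈ Ioc T t
        · rw [indicator_of_mem hs, norm_mul, nexp]
          apply mul_le_of_le_one_left (norm_nonneg _)
          rw [Real.exp_le_one_iff]
          exact mul_nonpos_of_nonpos_of_nonneg (by linarith) (by linarith [hs.2])
        · rw [indicator_of_notMem hs]; simp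
    rw [integral_zero] at key
    apply key.congr'
    filter_upwards [eventually_ge_atTop T] with t ht
    simp only [Gop, hμ, if_false]
    rw [integral_indicator measurableSet_Ioc, intervalIntegral.integral_of_le ht]

end LevinsonAux

section LevinsonFix
open Set Topology BoundedContinuousFunction

noncomputable def gw (a T L : ℝ) (t : ℝ) : ℝ := Real.exp (L * max (T - max t a) 0)

lemma gw_cont (a T L : ℝ) : Continuous (gw a T L) := by unfold gw; fun_prop

lemma gw_one {a T L : ℝ} (hL : 0 ≤ L) (t : ℝ) : 1 ≤ gw a T L t := by
  unfold gw
  rw [Real.one_le_exp_iff]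
  positivity

lemma gw_le {a T L : ℝ} (haT : a ≤ T) (hL : 0 ≤ L) (t : ℝ) :
    gw a T L t ≤ Real.exp (L * (T - a)) := by
  unfold gw
  gcongr
  apply max_le <;> linarith [le_max_right t a]

noncomputable def hv {n : ℕ} (a T L : ℝ) (B : ℝ → Matrix (Fin n) (Fin n) ℂ)
    (v : ℝ →ᵇ (Fin n → ℂ)) (i : Fin n) (s : ℝ) : ℂ :=
  ∑ j, B s i j * ((gw a T L s : ℂ) * v s j)

noncomputable def bet {n : ℕ} (B : ℝ → Matrix (Fin n) (Fin n) ℂ) (s : ℝ) : ℝ :=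
  ∑ i, ∑ j, ‖B s i j‖

variable {n : ℕ} {a T L : ℝ} {B : ℝ → Matrix (Fin n) (Fin n) ℂ}

lemma bet_nonneg (s : ℝ) : 0 ≤ bet B s :=
  Finset.sum_nonneg fun _ _ => Finset.sum_nonneg fun _ _ => norm_nonneg _

lemma bet_int (hi : ∀ i j, Integrable (fun t => B t i j)) : Integrable (bet B) :=
  integrable_finsetSum _ fun _ _ => integrable_finsetSum _ fun _ _ => (hi _ _).norm

lemma bet_cont {s : Set ℝ} (hc : ∀ i j, ContinuousOn (fun t => B t i j) s) :
    ContinuousOn (bet B) s :=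
  continuousOn_finsetSum _ fun _ _ => continuousOn_finsetSum _ fun _ _ => (hc _ _).norm

lemma hv_int (haT : a ≤ T) (hL : 0 ≤ L) (hi : ∀ i j, Integrable (fun t => B t i j))
    (v : ℝ →ᵇ (Fin n → ℂ)) (i : Fin n) : Integrable (hv a T L B v i) := by
  refine integrable_finsetSum _ fun j _ => ?_
  apply Integrable.mul_bdd (c := Real.exp (L * (T - a)) * ‖v‖) (hi i j)
  · apply Continuous.aestronglyMeasurable
    have := gw_cont a T L
    have := v.continuous
    fun_prop
  · refine Eventually.of_forall fun s => ?_
    rw [norm_mul, Complex.norm_real, Real.norm_of_nonneg (by linarith [gw_one (a := a) (T := T) hL s])]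
    exact mul_le_mul (gw_le haT hL s) ((norm_le_pi_norm (v s) j).trans (v.norm_coe_le_norm s))
      (norm_nonneg _) (Real.exp_pos _).le

lemma hv_bd (hL : 0 ≤ L) (v : ℝ →ᵇ (Fin n → ℂ)) (i : Fin n) (s : ℝ) :
    ‖hv a T L B v i s‖ ≤ bet B s * (gw a T L s * ‖v‖) := by
  have h1 := gw_one (a := a) (T := T) hL s
  calc ‖hv a T L B v i s‖ ≤ ∑ j, ‖B s i j‖ * (gw a T L s * ‖v‖) := by
        refine (norm_sum_le _ _).trans (Finset.sum_le_sum fun j _ => ?_)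
        rw [norm_mul, norm_mul, Complex.norm_real, Real.norm_of_nonneg (by linarith)]
        have := (norm_le_pi_norm (v s) j).trans (v.norm_coe_le_norm s)
        gcongr
    _ ≤ _ := by
        rw [← Finset.sum_mul]
        apply mul_le_mul_of_nonneg_right _ (by positivity)
        exact Finset.single_le_sum (f := fun i => ∑ j, ‖B s i j‖)
          (fun _ _ => Finset.sum_nonneg fun _ _ => norm_nonneg _) (Finset.mem_univ i)

lemma hv_sub (v w : ℝ →ᵇ (Fin n → ℂ)) (i : Fin n) (s : ℝ) :
    hv a T L B v i s - hv a T L B w i s = hv a T L B (v - w) i s := by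
  unfold hv
  rw [← Finset.sum_sub_distrib]
  refine Finset.sum_congr rfl fun j _ => ?_
  simp only [BoundedContinuousFunction.coe_sub, Pi.sub_apply]
  ring

lemma exp_int (hL : 0 < L) (t : ℝ) :
    ∫ s in t..T, Real.exp (L * (T - s)) = (Real.exp (L * (T - t)) - 1) / L := by
  have := intervalIntegral.integral_eq_sub_of_hasDerivAt (a := t) (b := T)
    (f := fun s => - Real.exp (L * (T - s)) / L) (f' := fun s => Real.exp (L * (T - s)))
    (fun s _ => by
      have := (((hasDerivAt_id s).const_sub T).const_mul L).exp.neg.div_const L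
      refine this.congr_deriv ?_
      simp only [id]
      field_simp)
    (Continuous.intervalIntegrable (by fun_prop) _ _)
  rw [this]
  simp
  ring

lemma G_main (haT : a ≤ T) (hL : 0 < L) (hi : ∀ i j, Integrable (fun t => B t i j))
    (hT : ∫ s in Ioi T, bet B s ≤ 1 / 4) {M : ℝ} (hM : ∀ s ∈ Icc a T, bet B s ≤ M)
    {μ : ℂ} {C : ℝ} (hC : ‖μ‖ ≤ C) (hLM : Real.exp (C * (T - a)) * M ≤ L / 4)
    (v : ℝ →ᵇ (Fin n → ℂ)) (i : Fin n) {t : ℝ} (hat : a ≤ t) :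
    ‖Gop μ T (hv a T L B v i) t‖ ≤ gw a T L t * (1 / 2 * ‖v‖) := by
  have hvInt := hv_int haT hL.le hi v i
  have g1 := gw_one (a := a) (T := T) hL.le t
  have hM0 : 0 ≤ M := (bet_nonneg a).trans (hM a ⟨le_rfl, haT⟩)
  have tail : ∫ s in Ioi T, ‖hv a T L B v i s‖ ≤ 1 / 4 * ‖v‖ := by
    calc ∫ s in Ioi T, ‖hv a T L B v i s‖ ≤ ∫ s in Ioi T, bet B s * ‖v‖ := by
          apply setIntegral_mono_on hvInt.norm.integrableOn
            ((bet_int hi).mul_const _).integrableOn measurableSet_Ioi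
          intro s hs
          have hs' : T < s := hs
          have := hv_bd (a := a) (T := T) (B := B) hL.le v i s
          have e : gw a T L s = 1 := by
            unfold gw
            rw [max_eq_left (a := s) (by linarith), max_eq_right (by linarith)]
            simp
          rwa [e, one_mul] at this
      _ = (∫ s in Ioi T, bet B s) * ‖v‖ := integral_mul_const _ _
      _ ≤ _ := by gcongr
  rcases le_total T t with h | h
  · refine (Gop_bdT μ hvInt h).trans (tail.trans ?_)
    nlinarith [norm_nonneg v]
  · refine (Gop_bda μ hvInt hat h hC).trans ?_
    have eg : ∀ s ∈ Icc t T, gw a T L s = Real.exp (L * (T - s)) := by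
      intro s hs
      unfold gw
      rw [max_eq_left (a := s) (by linarith [hs.1]), max_eq_left (by linarith [hs.2])]
    have mid : ∫ s in t..T, ‖hv a T L B v i s‖ ≤ M * ‖v‖ * (gw a T L t / L) := by
      calc ∫ s in t..T, ‖hv a T L B v i s‖
          ≤ ∫ s in t..T, (M * ‖v‖) * Real.exp (L * (T - s)) := by
            apply intervalIntegral.integral_mono_on h hvInt.norm.intervalIntegrable
              (Continuous.intervalIntegrable (by fun_prop) _ _)
            intro s hs
            refine (hv_bd hL.le v i s).trans ?_
            rw [eg s hs]
            have := hM s ⟨hat.trans hs.1, hs.2⟩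
            calc bet B s * (Real.exp (L * (T - s)) * ‖v‖)
                ≤ M * (Real.exp (L * (T - s)) * ‖v‖) := by gcongr
              _ = _ := by ring
        _ = (M * ‖v‖) * ((gw a T L t - 1) / L) := by
            rw [intervalIntegral.integral_const_mul, exp_int hL, eg t ⟨le_rfl, h⟩]
        _ ≤ _ := by gcongr; linarith
    have h3 : Real.exp (C * (T - a)) * (M * ‖v‖ * (gw a T L t / L))
        ≤ gw a T L t * (1 / 4 * ‖v‖) := by
      calc _ = (Real.exp (C * (T - a)) * M) * (‖v‖ * (gw a T L t / L)) := by ring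
        _ ≤ L / 4 * (‖v‖ * (gw a T L t / L)) := by gcongr
        _ = _ := by field_simp
    have h4 : Real.exp (C * (T - a)) * (∫ s in t..T, ‖hv a T L B v i s‖)
        ≤ gw a T L t * (1 / 4 * ‖v‖) := (by gcongr : _ ≤ _).trans h3
    nlinarith [norm_nonneg v]

lemma lev (n : ℕ) (a : ℝ) (μ : Fin n → ℂ) (k : Fin n) (hμ : μ k = 0)
    (B : ℝ → Matrix (Fin n) (Fin n) ℂ)
    (hc : ∀ i j, ContinuousOn (fun t => B t i j) (Ici a))
    (hi : ∀ i j, Integrable (fun t => B t i j)) :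
    ∃ z : ℝ → Fin n → ℂ,
      (∀ t > a, ∀ i, HasDerivAt (fun s => z s i) (μ i * z t i + ∑ j, B t i j * z t j) t) ∧
      ∀ i, Tendsto (fun t => z t i) atTop (𝓝 (if i = k then 1 else 0)) := by
  obtain ⟨T, haT, hT⟩ : ∃ T, a ≤ T ∧ ∫ s in Ioi T, bet B s ≤ 1 / 4 := by
    have h : Tendsto (fun T : ℝ => ∫ s in Ioi T, bet B s) atTop (𝓝 0) :=
      tendsto_integral_Ioi_zero tendsto_id
    have := (h.eventually (gt_mem_nhds (show (0:ℝ) < 1 / 4 by norm_num))).and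
      (eventually_ge_atTop a)
    obtain ⟨T, h1, h2⟩ := this.exists
    exact ⟨T, h2, h1.le⟩
  obtain ⟨M, hM⟩ : ∃ M, ∀ s ∈ Icc a T, bet B s ≤ M := by
    obtain ⟨M, hM⟩ := isCompact_Icc.exists_bound_of_continuousOn
      ((bet_cont hc).mono (Icc_subset_Ici_self : Icc a T ⊆ Ici a))
    exact ⟨M, fun s hs => (le_abs_self _).trans (hM s hs)⟩
  have hM0 : 0 ≤ M := (bet_nonneg a).trans (hM a ⟨le_rfl, haT⟩)
  set C : ℝ := ∑ i, ‖μ i‖ with hCdef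
  have hC : ∀ i, ‖μ i‖ ≤ C := fun i =>
    Finset.single_le_sum (f := fun i => ‖μ i‖) (fun _ _ => norm_nonneg _) (Finset.mem_univ i)
  obtain ⟨L, hL, hLM⟩ : ∃ L : ℝ, 0 < L ∧ Real.exp (C * (T - a)) * M ≤ L / 4 :=
    ⟨4 * (Real.exp (C * (T - a)) * M) + 1, by positivity, by linarith⟩
  have main := fun (v : ℝ →ᵇ (Fin n → ℂ)) (i : Fin n) (t : ℝ) (ht : a ≤ t) =>
    G_main haT hL hi hT hM (hC i) hLM v i ht
  have gmax : ∀ t, gw a T L (max t a) = gw a T L t := by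
    intro t; unfold gw; simp
  have g1 : ∀ t, 1 ≤ gw a T L t := gw_one hL.le
  have hvInt := hv_int (B := B) haT hL.le hi
  let f : (ℝ →ᵇ (Fin n → ℂ)) → ℝ → Fin n → ℂ := fun v t i =>
    (gw a T L t : ℂ)⁻¹ * ((if i = k then 1 else 0) + Gop (μ i) T (hv a T L B v i) (max t a))
  have fcont : ∀ v, Continuous (f v) := by
    intro v
    refine continuous_pi fun i => ?_
    have h1 := gw_cont a T L
    have h2 := Gop_cont (μ i) T (hvInt v i)
    apply Continuous.mul
    · apply Continuous.inv₀ (by fun_prop)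
      intro t
      exact_mod_cast (by linarith [g1 t] : gw a T L t ≠ 0)
    · fun_prop
  have nin : ∀ t, ‖(gw a T L t : ℂ)⁻¹‖ = (gw a T L t)⁻¹ := by
    intro t
    rw [norm_inv, Complex.norm_real, Real.norm_of_nonneg (by linarith [g1 t])]
  have fG : ∀ v i t, ‖(gw a T L t : ℂ)⁻¹ * Gop (μ i) T (hv a T L B v i) (max t a)‖
      ≤ 1 / 2 * ‖v‖ := by
    intro v i t
    have := main v i (max t a) (le_max_right _ _)
    rw [gmax] at this
    rw [norm_mul, nin, inv_mul_le_iff₀ (by linarith [g1 t])]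
    exact this
  have fbd : ∀ v t, ‖f v t‖ ≤ 1 + 1 / 2 * ‖v‖ := by
    intro v t
    rw [pi_norm_le_iff_of_nonneg (by positivity)]
    intro i
    simp only [f, mul_add]
    refine (norm_add_le _ _).trans (add_le_add ?_ (fG v i t))
    rw [norm_mul, nin]
    have : (gw a T L t)⁻¹ ≤ 1 := inv_le_one_of_one_le₀ (g1 t)
    split_ifs <;> simp [this]
  let F : (ℝ →ᵇ (Fin n → ℂ)) → (ℝ →ᵇ (Fin n → ℂ)) := fun v =>
    BoundedContinuousFunction.ofNormedAddCommGroup (f v) (fcont v) _ (fbd v)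
  have hF : ContractingWith (1 / 2) F := by
    refine ⟨by rw [← NNReal.coe_lt_coe]; norm_num, LipschitzWith.of_dist_le_mul fun v w => ?_⟩
    rw [BoundedContinuousFunction.dist_le (by positivity)]
    intro t
    rw [dist_pi_le_iff (by positivity)]
    intro i
    rw [dist_eq_norm, dist_eq_norm]
    have : (F v) t i - (F w) t i
        = (gw a T L t : ℂ)⁻¹ * Gop (μ i) T (hv a T L B (v - w) i) (max t a) := by
      have e : hv a T L B (v - w) i = fun s => hv a T L B v i s - hv a T L B w i s :=
        funext fun s => (hv_sub v w i s).symm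
      rw [e, ← Gop_sub (μ i) T (hvInt v i) (hvInt w i)]
      simp only [F, f, BoundedContinuousFunction.coe_ofNormedAddCommGroup]
      ring
    rw [this]
    simpa using fG (v - w) i t
  set v := ContractingWith.fixedPoint F hF
  have hv0 : F v = v := hF.fixedPoint_isFixedPt
  have hfix : ∀ t i, v t i = (gw a T L t : ℂ)⁻¹ *
      ((if i = k then 1 else 0) + Gop (μ i) T (hv a T L B v i) (max t a)) := by
    intro t i
    conv_lhs => rw [← hv0]
    rfl
  have hz : ∀ t, a ≤ t → ∀ i, (gw a T L t : ℂ) * v t i =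
      (if i = k then 1 else 0) + Gop (μ i) T (hv a T L B v i) t := by
    intro t ht i
    rw [hfix, max_eq_left ht, mul_inv_cancel_left₀]
    exact_mod_cast (by linarith [g1 t] : gw a T L t ≠ 0)
  refine ⟨fun t i => (gw a T L t : ℂ) * v t i, ?_, ?_⟩
  · intro t ht i
    have hcont : ContinuousAt (hv a T L B v i) t := by
      unfold hv
      have h1 := gw_cont a T L
      have h2 := v.continuous
      refine tendsto_finsetSum _ fun j _ => ?_
      apply ContinuousAt.mul ((hc i j).continuousAt (Ici_mem_nhds ht))
      fun_prop
    have hd := (Gop_deriv (μ i) T (hvInt v i) hcont).const_add (if i = k then (1:ℂ) else 0)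
    refine (hd.congr_of_eventuallyEq ?_).congr_deriv ?_
    · filter_upwards [Ici_mem_nhds ht] with s hs using hz s hs i
    · change _ = μ i * ((gw a T L t : ℂ) * v t i) + hv a T L B v i t
      rw [hz t (le_of_lt ht) i]
      by_cases h : i = k
      · subst h; simp [hμ]
      · simp [h]
  · intro i
    have := (Gop_tendsto (μ i) T (hvInt v i)).const_add (if i = k then (1:ℂ) else 0)
    rw [add_zero] at this
    apply this.congr'
    filter_upwards [eventually_ge_atTop a] with t ht
    exact (hz t ht i).symm

end LevinsonFix

section LevinsonFinal
open Set Topology Matrix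

def MD {n : ℕ} (W : ℝ → Matrix (Fin n) (Fin n) ℂ) (W' : Matrix (Fin n) (Fin n) ℂ) (t : ℝ) : Prop :=
  ∀ i k, HasDerivAt (fun s => W s i k) (W' i k) t

lemma MD.const_mul {n : ℕ} {W : ℝ → Matrix (Fin n) (Fin n) ℂ} {W' : Matrix (Fin n) (Fin n) ℂ}
    {t : ℝ} (h : MD W W' t) (S : Matrix (Fin n) (Fin n) ℂ) : MD (fun s => S * W s) (S * W') t := by
  intro i k
  simp only [Matrix.mul_apply]
  exact HasDerivAt.fun_sum fun j _ => (h j k).const_mul _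

lemma MD.mul_const {n : ℕ} {W : ℝ → Matrix (Fin n) (Fin n) ℂ} {W' : Matrix (Fin n) (Fin n) ℂ}
    {t : ℝ} (h : MD W W' t) (S : Matrix (Fin n) (Fin n) ℂ) : MD (fun s => W s * S) (W' * S) t := by
  intro i k
  simp only [Matrix.mul_apply]
  exact HasDerivAt.fun_sum fun j _ => (h i j).mul_const _

lemma mulVec_bd {n : ℕ} (A : Matrix (Fin n) (Fin n) ℂ) (x : Fin n → ℂ) {K : ℝ}
    (hK : ∑ i, ∑ j, ‖A i j‖ ≤ K) : ‖A *ᵥ x‖ ≤ K * ‖x‖ := by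
  have hK0 : 0 ≤ K :=
    (Finset.sum_nonneg fun _ _ => Finset.sum_nonneg fun _ _ => norm_nonneg _).trans hK
  rw [pi_norm_le_iff_of_nonneg (by positivity)]
  intro i
  calc ‖(A *ᵥ x) i‖ ≤ ∑ j, ‖A i j‖ * ‖x‖ := by
        have e : (A *ᵥ x) i = ∑ j, A i j * x j := rfl
        rw [e]
        refine (norm_sum_le _ _).trans (Finset.sum_le_sum fun j _ => ?_)
        rw [norm_mul]
        gcongr
        exact norm_le_pi_norm x j
    _ ≤ _ := by
        rw [← Finset.sum_mul]
        apply mul_le_mul_of_nonneg_right _ (norm_nonneg _)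
        refine le_trans ?_ hK
        exact Finset.single_le_sum (f := fun i => ∑ j, ‖A i j‖)
          (fun _ _ => Finset.sum_nonneg fun _ _ => norm_nonneg _) (Finset.mem_univ i)

lemma unit_back {n : ℕ} {a : ℝ} {u A : ℝ → Matrix (Fin n) (Fin n) ℂ}
    (hA : ∀ i j, ContinuousOn (fun t => A t i j) (Ici a))
    (hu : ∀ t > a, MD u (A t * u t) t) (hev : ∀ᶠ t in atTop, IsUnit (u t)) {t₀ : ℝ} (ht : a < t₀) :
    IsUnit (u t₀) := by
  obtain ⟨t₁, h1, h01⟩ := (hev.and (eventually_ge_atTop t₀)).exists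
  by_contra hcon
  rw [Matrix.isUnit_iff_isUnit_det, isUnit_iff_ne_zero, not_not] at hcon
  obtain ⟨c, hc0, hc⟩ := Matrix.exists_mulVec_eq_zero_iff.2 hcon
  obtain ⟨K, hK⟩ := isCompact_Icc.exists_bound_of_continuousOn
    ((bet_cont hA).mono (fun s hs => ht.le.trans hs.1 : Icc t₀ t₁ ⊆ Ici a))
  have hK' : ∀ s ∈ Icc t₀ t₁, ∑ i, ∑ j, ‖A s i j‖ ≤ K := fun s hs =>
    (le_abs_self _).trans (hK s hs)
  have hK0 : 0 ≤ K := (bet_nonneg t₀).trans (hK' t₀ ⟨le_rfl, h01⟩)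
  have hd : ∀ t > a, HasDerivAt (fun s => u s *ᵥ c) (A t *ᵥ (u t *ᵥ c)) t := by
    intro t ht
    rw [hasDerivAt_pi]
    intro i
    rw [Matrix.mulVec_mulVec]
    simp only [Matrix.mulVec, dotProduct]
    exact HasDerivAt.fun_sum fun j _ => (hu t ht i j).mul_const _
  have := ODE_solution_unique_of_mem_Icc_right (v := fun t x => A t *ᵥ x) (K := ⟨K, hK0⟩)
    (s := fun _ => univ) (a := t₀) (b := t₁) (f := fun s => u s *ᵥ c) (g := fun _ => 0)
    (by
      intro t htt
      refine (LipschitzWith.of_dist_le_mul fun x y => ?_).lipschitzOnWith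
      rw [dist_eq_norm, dist_eq_norm, ← Matrix.mulVec_sub]
      exact mulVec_bd _ _ (hK' t ⟨htt.1, htt.2.le⟩))
    (fun t htt => (hd t (lt_of_lt_of_le ht htt.1)).continuousAt.continuousWithinAt)
    (fun t htt => (hd t (lt_of_lt_of_le ht htt.1)).hasDerivWithinAt)
    (fun _ _ => mem_univ _) continuousOn_const
    (fun t htt => by
      simp only [Matrix.mulVec_zero]
      exact hasDerivWithinAt_const _ _ _)
    (fun _ _ => mem_univ _) hc
  have h2 := this (right_mem_Icc.2 h01)
  simp only at h2
  rw [Matrix.isUnit_iff_isUnit_det, isUnit_iff_ne_zero] at h1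
  exact h1 (Matrix.exists_mulVec_eq_zero_iff.1 ⟨c, hc0, h2⟩)

end LevinsonFinal

theorem stmt_13 (n : ℕ) (hn : 1 ≤ n) (a : ℝ)
    (A₀ : Matrix (Fin n) (Fin n) ℂ) (e' : Fin n → (Fin n → ℂ)) (lam : Fin n → ℂ)
    (P : Fin n → Matrix (Fin n) (Fin n) ℂ)
    (hindep : LinearIndependent ℂ e')
    (hspan : Submodule.span ℂ (Set.range e') = ⊤)
    (heig : ∀ j, A₀.mulVec (e' j) = lam j • e' j)
    (hP : ∀ j k, (P j).mulVec (e' k) = if j = k then e' j else 0)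
    (A₁ : ℝ → Matrix (Fin n) (Fin n) ℂ)
    (hA₁cont : ∀ j k, ContinuousOn (fun t => A₁ t j k) (Set.Ici a))
    (hA₁int : ∀ j k, IntegrableOn (fun t => A₁ t j k) (Set.Ici a) volume) :
    ∃ R : ℝ → Matrix (Fin n) (Fin n) ℂ,
      (∀ j k, ContDiffOn ℝ 1 (fun t => R t j k) (Set.Ioi a)) ∧
      (∀ j k, Tendsto (fun t => R t j k) atTop (nhds 0)) ∧
      ∀ t ∈ Set.Ioi a,
        IsUnit (uSol n lam R P t) ∧
        ∀ i k, HasDerivAt (fun s => uSol n lam R P s i k)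
          (((A₀ + A₁ t) * uSol n lam R P t) i k) t := by
  classical
  set S : Matrix (Fin n) (Fin n) ℂ := Matrix.of fun i j => e' j i with hS
  have hSu : IsUnit S := by
    rw [← Matrix.linearIndependent_cols_iff_isUnit]
    exact hindep
  have hdet : IsUnit S.det := (Matrix.isUnit_iff_isUnit_det S).1 hSu
  have hSS : S * S⁻¹ = 1 := Matrix.mul_nonsing_inv S hdet
  have hSS' : S⁻¹ * S = 1 := Matrix.nonsing_inv_mul S hdet
  have hA₀ : A₀ * S = S * Matrix.diagonal lam := by
    ext i k
    rw [Matrix.mul_diagonal]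
    have := congrFun (heig k) i
    simp only [Pi.smul_apply, smul_eq_mul] at this
    rw [Matrix.mul_apply]
    simp only [hS, Matrix.of_apply]
    rw [mul_comm (e' k i), ← this]
    rfl
  have hPj : ∀ j, P j = S * Matrix.single j j 1 * S⁻¹ := by
    intro j
    have : P j * S = S * Matrix.single j j 1 := by
      ext i k
      have h := congrFun (hP j k) i
      have h2 : (P j * S) i k = (P j).mulVec (e' k) i := rfl
      rw [h2, h]
      by_cases hjk : j = k
      · subst hjk; simp [hS]
      · rw [Matrix.mul_single_apply_of_ne _ _ _ _ _ (Ne.symm hjk)]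
        simp [hjk]
    rw [← this, Matrix.mul_assoc, hSS, Matrix.mul_one]
  let A₁' : ℝ → Matrix (Fin n) (Fin n) ℂ := fun t =>
    Matrix.of fun i j => (Set.Ici a).indicator (fun t => A₁ t i j) t
  have hA₁' : ∀ t, a ≤ t → A₁' t = A₁ t := by
    intro t ht
    ext i j
    simp [A₁', ht]
  let B : ℝ → Matrix (Fin n) (Fin n) ℂ := fun t => S⁻¹ * A₁' t * S
  have hBent : ∀ i j t, B t i j = ∑ l, (∑ m, S⁻¹ i m * A₁' t m l) * S l j := by
    intro i j t
    simp only [B, Matrix.mul_apply]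
  have hA₁'c : ∀ i j, ContinuousOn (fun t => A₁' t i j) (Set.Ici a) := fun i j =>
    (hA₁cont i j).congr fun t ht => by rw [hA₁' t ht]
  have hA₁'i : ∀ i j, Integrable (fun t => A₁' t i j) := fun i j =>
    (integrable_indicator_iff measurableSet_Ici).2 (hA₁int i j)
  have hBc : ∀ i j, ContinuousOn (fun t => B t i j) (Set.Ici a) := by
    intro i j
    simp only [hBent]
    exact continuousOn_finsetSum _ fun l _ => ContinuousOn.mul
      (continuousOn_finsetSum _ fun m _ => continuousOn_const.mul (hA₁'c m l)) continuousOn_const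
  have hBi : ∀ i j, Integrable (fun t => B t i j) := by
    intro i j
    simp only [hBent]
    exact integrable_finsetSum _ fun l _ => Integrable.mul_const
      (integrable_finsetSum _ fun m _ => (hA₁'i m l).const_mul _) _
  choose z hz hzlim using fun k => lev n a (fun i => lam i - lam k) k (sub_self _) B hBc hBi
  let Z : ℝ → Matrix (Fin n) (Fin n) ℂ := fun t => Matrix.of fun i k => z k t i
  let Z' : ℝ → Matrix (Fin n) (Fin n) ℂ := fun t =>
    Matrix.of fun i k => (lam i - lam k) * Z t i k + ∑ j, B t i j * Z t j k
  have hZ : ∀ t > a, MD Z (Z' t) t := fun t ht i k => hz k t ht i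
  have hZlim : ∀ i k, Tendsto (fun t => Z t i k) atTop (nhds ((1 : Matrix (Fin n) (Fin n) ℂ) i k)) := by
    intro i k
    have := hzlim k i
    rwa [← Matrix.one_apply] at this
  let W : ℝ → Matrix (Fin n) (Fin n) ℂ := fun t =>
    Z t * Matrix.diagonal (fun j => Complex.exp (lam j * t))
  have hW : ∀ t > a, MD W ((Matrix.diagonal lam + B t) * W t) t := by
    intro t ht i k
    have h2 : HasDerivAt (fun u : ℝ => Complex.exp (lam k * u))
        (Complex.exp (lam k * t) * (lam k * 1)) t :=
      ((Complex.ofRealCLM.hasDerivAt (x := t)).const_mul (lam k)).cexp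
    have h3 := (hZ t ht i k).mul h2
    have e : (fun s => W s i k) = fun s : ℝ => Z s i k * Complex.exp (lam k * s) := by
      funext s
      simp only [W, Matrix.mul_diagonal]
    rw [e]
    refine h3.congr_deriv ?_
    rw [Matrix.add_mul, Matrix.add_apply, Matrix.diagonal_mul, Matrix.mul_apply]
    simp only [W, Matrix.mul_diagonal, Z', Matrix.of_apply]
    simp only [← mul_assoc]
    rw [← Finset.sum_mul]
    ring
  let R : ℝ → Matrix (Fin n) (Fin n) ℂ := fun t => S * Z t * S⁻¹ - 1
  have hu : ∀ t, uSol n lam R P t = S * W t * S⁻¹ := by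
    intro t
    have hdiag : Matrix.diagonal (fun j => Complex.exp (lam j * t))
        = ∑ j, Complex.exp (lam j * t) • Matrix.single j j (1:ℂ) := by
      ext i k
      rw [Matrix.sum_apply]
      simp only [Matrix.smul_apply, Matrix.single_apply, Matrix.diagonal_apply, smul_eq_mul,
        mul_ite, mul_one, mul_zero, ite_and]
      rw [Finset.sum_ite_eq' Finset.univ i]
      simp
    simp only [uSol, R, W, add_sub_cancel, hdiag, Finset.mul_sum, Finset.sum_mul,
      Matrix.mul_smul, Matrix.smul_mul]
    refine Finset.sum_congr rfl fun j _ => ?_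
    rw [hPj j]
    congr 1
    calc S * Z t * S⁻¹ * (S * Matrix.single j j 1 * S⁻¹)
        = S * Z t * (S⁻¹ * S) * Matrix.single j j 1 * S⁻¹ := by simp only [Matrix.mul_assoc]
      _ = _ := by rw [hSS', Matrix.mul_one]; simp only [Matrix.mul_assoc]
  have hRder : ∀ t > a, MD R (S * Z' t * S⁻¹) t := fun t ht i k =>
    ((((hZ t ht).const_mul S).mul_const S⁻¹) i k).sub_const _
  have huder : ∀ t > a, MD (uSol n lam R P) ((A₀ + A₁ t) * uSol n lam R P t) t := by
    intro t ht
    have h1 := ((hW t ht).const_mul S).mul_const S⁻¹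
    rw [show uSol n lam R P = _ from funext hu]
    convert h1 using 1
    simp only [B, hA₁' t (le_of_lt ht)]
    have : S * (Matrix.diagonal lam + S⁻¹ * A₁ t * S) = (A₀ + A₁ t) * S := by
      rw [Matrix.mul_add, Matrix.add_mul, hA₀]
      congr 1
      rw [← Matrix.mul_assoc, ← Matrix.mul_assoc, hSS, Matrix.one_mul]
    rw [← Matrix.mul_assoc S (_ + _), this]
    simp only [Matrix.mul_assoc]
  refine ⟨R, ?_, ?_, ?_⟩
  · intro j k
    have hZc : ∀ i k, ContinuousOn (fun t => Z t i k) (Set.Ioi a) := fun i k t ht =>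
      (hZ t ht i k).continuousAt.continuousWithinAt
    have hZ'c : ∀ i k, ContinuousOn (fun t => Z' t i k) (Set.Ioi a) := fun i k =>
      (continuousOn_const.mul (hZc i k)).add (continuousOn_finsetSum _ fun l _ =>
        ((hBc i l).mono Set.Ioi_subset_Ici_self).mul (hZc l k))
    rw [show (1 : WithTop ℕ∞) = 0 + 1 from rfl, contDiffOn_succ_iff_deriv_of_isOpen isOpen_Ioi]
    refine ⟨fun t ht => (hRder t ht j k).differentiableAt.differentiableWithinAt, by simp, ?_⟩
    rw [contDiffOn_zero]
    have : ContinuousOn (fun t => (S * Z' t * S⁻¹) j k) (Set.Ioi a) := by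
      simp only [Matrix.mul_apply]
      exact continuousOn_finsetSum _ fun l _ => ContinuousOn.mul
        (continuousOn_finsetSum _ fun m _ => continuousOn_const.mul (hZ'c m l)) continuousOn_const
    exact this.congr fun t ht => (hRder t ht j k).deriv
  · intro j k
    have h1 : Tendsto (fun t => (S * Z t * S⁻¹) j k) atTop
        (nhds ((S * (1 : Matrix (Fin n) (Fin n) ℂ) * S⁻¹) j k)) := by
      simp only [Matrix.mul_apply (N := S⁻¹), Matrix.mul_apply (M := S)]
      exact tendsto_finsetSum _ fun l _ => Tendsto.mul_const _
        (tendsto_finsetSum _ fun m _ => (hZlim m l).const_mul _)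
    rw [Matrix.mul_one, hSS] at h1
    have h2 := h1.sub_const ((1 : Matrix (Fin n) (Fin n) ℂ) j k)
    rw [sub_self] at h2
    exact h2
  · have hev : ∀ᶠ t in atTop, IsUnit (uSol n lam R P t) := by
      have h1 : Tendsto Z atTop (nhds 1) :=
        tendsto_pi_nhds.2 fun i => tendsto_pi_nhds.2 fun k => hZlim i k
      have h2 : Tendsto (fun t => (Z t).det) atTop (nhds (1 : Matrix (Fin n) (Fin n) ℂ).det) :=
        ((Continuous.matrix_det continuous_id).tendsto _).comp h1
      rw [Matrix.det_one] at h2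
      filter_upwards [h2.eventually_ne one_ne_zero] with t ht
      rw [hu t, Matrix.isUnit_iff_isUnit_det, isUnit_iff_ne_zero]
      simp only [W, Matrix.det_mul, Matrix.det_diagonal]
      have h3 : S⁻¹.det ≠ 0 := (Matrix.isUnit_nonsing_inv_det S hdet).ne_zero
      have h4 : ∏ j, Complex.exp (lam j * t) ≠ 0 :=
        Finset.prod_ne_zero_iff.2 fun j _ => Complex.exp_ne_zero _
      exact mul_ne_zero (mul_ne_zero hdet.ne_zero (mul_ne_zero ht h4)) h3
    intro t ht
    refine ⟨unit_back (a := a) (A := fun t => A₀ + A₁ t) ?_ huder hev ht, huder t ht⟩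
    intro i j
    exact continuousOn_const.add (hA₁cont i j)
end

section
/- Let n ≥ 1, a, t₀ ∈ ℝ with a < t₀, μ ∈ ℕ, and set α_μ := 1 if μ = 0 and α_μ := μ otherwise. Let A₀ be a diagonalizable complex n×n matrix, let e′₁,…,e′ₙ be a basis of ℂⁿ of eigenvectors of A₀ with A₀e′ⱼ = λⱼe′ⱼ, and for each j let Pⱼ be the matrix of the projection of ℂⁿ onto ℂ·e′ⱼ along the span of the remaining basis vectors. Let A₁ : (a,t₀) → M(n×n,ℂ) be continuous such that for some c ∈ (a,t₀) every entry of A₁ restricted to [c,t₀) is Lebesgue integrable. Then there exists a continuously differentiable map R : (a,t₀) → M(n×n,ℂ) with limₜ→t₀ Rⱼₖ(t) = 0 for all j,k, such that u : (a,t₀) → M(n×n,ℂ) defined by u(t) := Σⱼ (t₀−t)^{−λⱼ} (E + R(t)) Pⱼ if μ = 0, and u(t) := Σⱼ exp(λⱼ(t₀−t)^{−μ}) (E + R(t)) Pⱼ if μ ≠ 0, takes values in the invertible n×n matrices and satisfies u′(t) = ( (α_μ/(t₀−t)^{μ+1}) A₀ + A₁(t) ) · u(t) for all t ∈ (a,t₀).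 -/
open MeasureTheory Filter

/-- The candidate fundamental matrix near the finite singular point `t₀`:
`u(t) = Σⱼ (t₀−t)^{−λⱼ}·(E + R(t))·Pⱼ` for `μ = 0` and
`u(t) = Σⱼ exp(λⱼ(t₀−t)^{−μ})·(E + R(t))·Pⱼ` for `μ ≠ 0`. -/
noncomputable def uSolSing (n : ℕ) (t₀ : ℝ) (μ : ℕ) (lam : Fin n → ℂ)
    (R : ℝ → Matrix (Fin n) (Fin n) ℂ) (P : Fin n → Matrix (Fin n) (Fin n) ℂ)
    (t : ℝ) : Matrix (Fin n) (Fin n) ℂ :=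
  if μ = 0 then
    ∑ j, (((t₀ - t : ℝ) : ℂ) ^ (-lam j)) • ((1 + R t) * P j)
  else
    ∑ j, Complex.exp (lam j * (((t₀ - t) ^ μ : ℝ) : ℂ)⁻¹) • ((1 + R t) * P j)

namespace Lev

open Set Topology

structure Setup (a t₀ c : ℝ) (φ φ' β : ℝ → ℝ) : Prop where
  hc : c ∈ Ioo a t₀
  hφ : ∀ t ∈ Ioo a t₀, HasDerivAt φ (φ' t) t
  hφ' : ∀ t ∈ Ioo a t₀, 0 ≤ φ' t
  hφlim : Tendsto φ (𝓝[<] t₀) atTop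
  β0 : ∀ t, 0 ≤ β t
  βc : ContinuousOn β (Ioo a t₀)
  βi : ∀ t ∈ Ioo a t₀, IntervalIntegrable β volume t t₀
  βs : ∫ s in c..t₀, β s ≤ 1 / 8

noncomputable def Mw (β : ℝ → ℝ) (t₀ t : ℝ) : ℝ := ∫ s in t..t₀, β s

noncomputable def wt (φ β : ℝ → ℝ) (t₀ c L t : ℝ) : ℝ :=
  Real.exp (-2 * Mw β t₀ t - L * max (φ c - φ t) 0)

noncomputable def base (t₀ c : ℝ) (d : ℂ) : ℝ := if 0 ≤ d.re then t₀ else c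

noncomputable def gf (φ : ℝ → ℝ) (d : ℂ) (f : ℝ → ℂ) (s : ℝ) : ℂ :=
  Complex.exp (-(d * φ s)) * f s

noncomputable def J (φ : ℝ → ℝ) (t₀ c : ℝ) (d : ℂ) (f : ℝ → ℂ) (t : ℝ) : ℂ :=
  Complex.exp (d * φ t) * ∫ s in (base t₀ c d)..t, gf φ d f s

section
variable {a t₀ c : ℝ} {φ φ' β : ℝ → ℝ}

lemma sma {E : Type*} [NormedAddCommGroup E] {g : ℝ → E}
    (hg : ContinuousOn g (Ioo a t₀)) {t : ℝ} (ht : t ∈ Ioo a t₀) :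
    StronglyMeasurableAtFilter g (𝓝 t) :=
  hg.stronglyMeasurableAtFilter isOpen_Ioo t ht

lemma cat {E : Type*} [TopologicalSpace E] {g : ℝ → E}
    (hg : ContinuousOn g (Ioo a t₀)) {t : ℝ} (ht : t ∈ Ioo a t₀) : ContinuousAt g t :=
  hg.continuousAt (isOpen_Ioo.mem_nhds ht)

lemma ii_in {E : Type*} [NormedAddCommGroup E] {g : ℝ → E}
    (hg : ContinuousOn g (Ioo a t₀)) {s t : ℝ} (hs : s ∈ Ioo a t₀) (ht : t ∈ Ioo a t₀) :
    IntervalIntegrable g volume s t :=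
  (hg.mono (ordConnected_Ioo.uIcc_subset hs ht)).intervalIntegrable

lemma Setup.cφ (h : Setup a t₀ c φ φ' β) : ContinuousOn φ (Ioo a t₀) :=
  fun t ht => (h.hφ t ht).continuousAt.continuousWithinAt

lemma Setup.mφ (h : Setup a t₀ c φ φ' β) : MonotoneOn φ (Ioo a t₀) := by
  apply monotoneOn_of_deriv_nonneg (convex_Ioo _ _) h.cφ
  · rw [interior_Ioo]
    exact fun t ht => (h.hφ t ht).differentiableAt.differentiableWithinAt
  · rw [interior_Ioo]
    intro t ht
    rw [(h.hφ t ht).deriv]; exact h.hφ' t ht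

lemma Setup.dM (h : Setup a t₀ c φ φ' β) {t : ℝ} (ht : t ∈ Ioo a t₀) :
    HasDerivAt (Mw β t₀) (-β t) t :=
  intervalIntegral.integral_hasDerivAt_left (h.βi t ht) (sma h.βc ht) (cat h.βc ht)

lemma Setup.cM (h : Setup a t₀ c φ φ' β) {t : ℝ} (ht : t ∈ Ioo a t₀) :
    ContinuousOn (Mw β t₀) (Icc t t₀) := by
  have := intervalIntegral.continuousOn_primitive_interval_left (μ := volume) (f := β) (a := t)
    (b := t₀) (by
      rw [uIcc_of_le ht.2.le]
      exact (intervalIntegrable_iff_integrableOn_Icc_of_le ht.2.le).1 (h.βi t ht))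
  rwa [uIcc_of_le ht.2.le] at this

lemma M_t0 : Mw β t₀ t₀ = 0 := by simp [Mw]

lemma Setup.M0 (h : Setup a t₀ c φ φ' β) {t : ℝ} (ht : t ≤ t₀) : 0 ≤ Mw β t₀ t :=
  intervalIntegral.integral_nonneg ht (fun s _ => h.β0 s)

lemma Setup.mM (h : Setup a t₀ c φ φ' β) {s t : ℝ} (hs : s ∈ Ioo a t₀) (hst : s ≤ t)
    (ht : t < t₀) : Mw β t₀ t ≤ Mw β t₀ s := by
  have ht' : t ∈ Ioo a t₀ := ⟨hs.1.trans_le hst, ht⟩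
  have := intervalIntegral.integral_add_adjacent_intervals (ii_in h.βc hs ht') (h.βi t ht')
  have h2 : 0 ≤ ∫ x in s..t, β x := intervalIntegral.integral_nonneg hst (fun s _ => h.β0 s)
  unfold Mw; linarith

lemma Setup.limM (h : Setup a t₀ c φ φ' β) : Tendsto (Mw β t₀) (𝓝[<] t₀) (𝓝 0) := by
  have h1 := h.cM h.hc t₀ ⟨h.hc.2.le, le_rfl⟩
  rw [ContinuousWithinAt, M_t0] at h1
  refine h1.mono_left ?_
  rw [← nhdsWithin_Ico_eq_nhdsLT h.hc.2]
  exact nhdsWithin_mono _ Ico_subset_Icc_self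

lemma wt_pos {L t : ℝ} : 0 < wt φ β t₀ c L t := Real.exp_pos _

lemma Setup.cw (h : Setup a t₀ c φ φ' β) (L : ℝ) : ContinuousOn (wt φ β t₀ c L) (Ioo a t₀) := by
  have h1 : ContinuousOn (Mw β t₀) (Ioo a t₀) :=
    fun t ht => (h.dM ht).continuousAt.continuousWithinAt
  have h2 := h.cφ
  unfold wt
  fun_prop

lemma Setup.wt_le_one (h : Setup a t₀ c φ φ' β) {L t : ℝ} (hL : 0 ≤ L) (ht : t ≤ t₀) :
    wt φ β t₀ c L t ≤ 1 := by
  unfold wt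
  rw [Real.exp_le_one_iff]
  have := h.M0 ht
  have := mul_nonneg hL (le_max_right (φ c - φ t) 0)
  linarith

lemma Setup.wt_mono (h : Setup a t₀ c φ φ' β) {L s t : ℝ} (hL : 0 ≤ L) (hs : s ∈ Ioo a t₀)
    (hst : s ≤ t) (ht : t < t₀) : wt φ β t₀ c L s ≤ wt φ β t₀ c L t := by
  unfold wt
  have ht' : t ∈ Ioo a t₀ := ⟨hs.1.trans_le hst, ht⟩
  have h1 := h.mM hs hst ht
  have h2 := h.mφ hs ht' hst
  have h3 : max (φ c - φ t) 0 ≤ max (φ c - φ s) 0 := max_le_max (by linarith) le_rfl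
  have h4 := mul_le_mul_of_nonneg_left h3 hL
  apply Real.exp_le_exp.2
  linarith

lemma Setup.key (h : Setup a t₀ c φ φ' β) {L s t : ℝ} {d : ℂ} (hd : ‖d‖ ≤ L)
    (ht : t ∈ Ioo a t₀) (hts : t ≤ s) (hs : s < t₀) (hor : 0 ≤ d.re ∨ s ≤ c) :
    Real.exp (d.re * (φ t - φ s)) * wt φ β t₀ c L t ≤
      Real.exp (-2 * (Mw β t₀ t - Mw β t₀ s)) * wt φ β t₀ c L s := by
  have hs' : s ∈ Ioo a t₀ := ⟨ht.1.trans_le hts, hs⟩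
  have h2 := h.mφ ht hs' hts
  have hL : 0 ≤ L := (norm_nonneg d).trans hd
  unfold wt
  rw [← Real.exp_add, ← Real.exp_add]
  apply Real.exp_le_exp.2
  suffices d.re * (φ t - φ s) - L * max (φ c - φ t) 0 ≤ - L * max (φ c - φ s) 0 by linarith
  rcases hor with hor | hor
  · have h3 : max (φ c - φ s) 0 ≤ max (φ c - φ t) 0 := max_le_max (by linarith) le_rfl
    nlinarith [mul_le_mul_of_nonneg_left h3 hL, mul_nonneg hor (sub_nonneg.2 h2)]
  · have h4 := h.mφ hs' h.hc hor
    rw [max_eq_left (by linarith), max_eq_left (by linarith)]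
    have h5 : -L ≤ d.re := by
      have := (abs_le.1 (Complex.abs_re_le_norm d)).1
      linarith
    nlinarith

lemma Setup.kint (h : Setup a t₀ c φ φ' β) {q t : ℝ} (ht : t ∈ Ioo a t₀) (htq : t ≤ q)
    (hq : q ≤ t₀) :
    IntervalIntegrable (fun s => β s * Real.exp (-2 * (Mw β t₀ t - Mw β t₀ s))) volume t q ∧
    ∫ s in t..q, β s * Real.exp (-2 * (Mw β t₀ t - Mw β t₀ s)) ≤ 1 / 2 := by
  have hcM : ContinuousOn (Mw β t₀) (Icc t q) := (h.cM ht).mono (Icc_subset_Icc_right hq)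
  have hβ : IntervalIntegrable β volume t q := (h.βi t ht).mono_set (by
    rw [uIcc_of_le htq, uIcc_of_le ht.2.le]; exact Icc_subset_Icc_right hq)
  have hI : IntervalIntegrable (fun s => β s * Real.exp (-2 * (Mw β t₀ t - Mw β t₀ s)))
      volume t q := by
    apply hβ.mul_continuousOn
    rw [uIcc_of_le htq]
    fun_prop
  refine ⟨hI, ?_⟩
  have := intervalIntegral.integral_eq_sub_of_hasDerivAt_of_le
    (f := fun s => -(1 / 2) * Real.exp (-2 * (Mw β t₀ t - Mw β t₀ s)))
    (f' := fun s => β s * Real.exp (-2 * (Mw β t₀ t - Mw β t₀ s))) htq (by fun_prop)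
    (by
      intro s hs
      have h1 := h.dM (t := s) ⟨ht.1.trans hs.1, hs.2.trans_le hq⟩
      have h2 := (((h1.const_sub (Mw β t₀ t)).const_mul (-2)).exp).const_mul (-(1/2) : ℝ)
      refine h2.congr_deriv ?_
      ring) hI
  rw [this]
  simp only [sub_self, mul_zero, Real.exp_zero]
  have := Real.exp_pos (-2 * (Mw β t₀ t - Mw β t₀ q))
  linarith

end
section
variable {a t₀ c L C : ℝ} {φ φ' β : ℝ → ℝ} {d : ℂ} {f : ℝ → ℂ}

lemma ae_ne (t₀ : ℝ) : ∀ᵐ s : ℝ, s ≠ t₀ := by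
  simpa using (Set.countable_singleton t₀).ae_notMem (volume : Measure ℝ)

lemma norm_expd (d : ℂ) (x : ℝ) : ‖Complex.exp (d * x)‖ = Real.exp (d.re * x) := by
  rw [Complex.norm_exp]; simp

lemma norm_gf (s : ℝ) : ‖gf φ d f s‖ = Real.exp (-(d.re * φ s)) * ‖f s‖ := by
  unfold gf
  rw [norm_mul, ← neg_mul, norm_expd]; simp

lemma Setup.cgf (h : Setup a t₀ c φ φ' β) (hf : ContinuousOn f (Ioo a t₀)) :
    ContinuousOn (gf φ d f) (Ioo a t₀) := by
  have := h.cφ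
  unfold gf
  fun_prop

lemma Setup.f_le (h : Setup a t₀ c φ φ' β) (hL : 0 ≤ L) (hC : 0 ≤ C)
    (hfb : ∀ s ∈ Ioo a t₀, ‖f s‖ * wt φ β t₀ c L s ≤ C * β s) {s t : ℝ} (ht : t ∈ Ioo a t₀)
    (hts : t ≤ s) (hs : s < t₀) : ‖f s‖ ≤ C / wt φ β t₀ c L t * β s := by
  have h1 := hfb s ⟨ht.1.trans_le hts, hs⟩
  have h2 := h.wt_mono hL ht hts hs
  rw [div_mul_eq_mul_div, le_div_iff₀ wt_pos]
  exact (mul_le_mul_of_nonneg_left h2 (norm_nonneg _)).trans h1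

lemma Setup.igf (h : Setup a t₀ c φ φ' β) (hL : 0 ≤ L) (hC : 0 ≤ C)
    (hf : ContinuousOn f (Ioo a t₀))
    (hfb : ∀ s ∈ Ioo a t₀, ‖f s‖ * wt φ β t₀ c L s ≤ C * β s) {t : ℝ} (ht : t ∈ Ioo a t₀) :
    IntervalIntegrable (gf φ d f) volume (base t₀ c d) t := by
  unfold base
  split_ifs with hd
  · apply IntervalIntegrable.symm
    have hb := (h.βi t ht).const_mul (Real.exp (-(d.re * φ t)) * (C / wt φ β t₀ c L t))
    rw [intervalIntegrable_iff_integrableOn_Ioo_of_le ht.2.le] at hb ⊢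
    refine Integrable.mono' hb ?_ ?_
    · exact ((h.cgf hf).mono (Ioo_subset_Ioo_left ht.1.le)).aestronglyMeasurable measurableSet_Ioo
    · refine (ae_restrict_iff' measurableSet_Ioo).2 (Eventually.of_forall fun s hs => ?_)
      rw [norm_gf, mul_assoc]
      have h1 := h.f_le hL hC hfb ht hs.1.le hs.2
      have h2 := h.mφ ht ⟨ht.1.trans hs.1, hs.2⟩ hs.1.le
      have h3 : Real.exp (-(d.re * φ s)) ≤ Real.exp (-(d.re * φ t)) := by
        apply Real.exp_le_exp.2
        nlinarith
      exact mul_le_mul h3 h1 (norm_nonneg _) (Real.exp_pos _).le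
  · exact ii_in (h.cgf hf) h.hc ht

lemma Setup.dJ (h : Setup a t₀ c φ φ' β) (hL : 0 ≤ L) (hC : 0 ≤ C)
    (hf : ContinuousOn f (Ioo a t₀))
    (hfb : ∀ s ∈ Ioo a t₀, ‖f s‖ * wt φ β t₀ c L s ≤ C * β s) {t : ℝ} (ht : t ∈ Ioo a t₀) :
    HasDerivAt (J φ t₀ c d f) (φ' t * d * J φ t₀ c d f t + f t) t := by
  have h1 := intervalIntegral.integral_hasDerivAt_right (h.igf (d := d) hL hC hf hfb ht)
    (sma (h.cgf hf) ht) (cat (h.cgf hf) ht)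
  have h2 := (((h.hφ t ht).ofReal_comp).const_mul d).cexp
  refine (h2.mul h1).congr_deriv ?_
  unfold J
  have : Complex.exp (d * φ t) * gf φ d f t = f t := by
    unfold gf
    rw [← mul_assoc, ← Complex.exp_add]; simp
  rw [this]
  ring

lemma J_eq (t : ℝ) : J φ t₀ c d f t =
    ∫ s in (base t₀ c d)..t, Complex.exp (d * (φ t - φ s : ℝ)) * f s := by
  unfold J gf
  rw [← intervalIntegral.integral_const_mul]
  congr 1
  ext s
  rw [← mul_assoc, ← Complex.exp_add]
  congr 2
  push_cast; ring

lemma Setup.bJ (h : Setup a t₀ c φ φ' β) (hd : ‖d‖ ≤ L) (hC : 0 ≤ C)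
    (hfb : ∀ s ∈ Ioo a t₀, ‖f s‖ * wt φ β t₀ c L s ≤ C * β s) {t : ℝ} (ht : t ∈ Ioo a t₀) :
    ‖J φ t₀ c d f t‖ * wt φ β t₀ c L t ≤ C * (1 / 2) := by
  have hL : 0 ≤ L := (norm_nonneg d).trans hd
  have wp : ∀ s, 0 < wt φ β t₀ c L s := fun s => wt_pos
  have back : ∀ q, t ≤ q → q ≤ t₀ → (0 ≤ d.re ∨ q ≤ c) →
      ‖∫ s in t..q, Complex.exp (d * (φ t - φ s : ℝ)) * f s‖ * wt φ β t₀ c L t ≤ C * (1 / 2) := by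
    intro q htq hq hor
    obtain ⟨hi, hle⟩ := h.kint ht htq hq
    have hb : ‖∫ s in t..q, Complex.exp (d * (φ t - φ s : ℝ)) * f s‖ ≤
        ∫ s in t..q, (C / wt φ β t₀ c L t) *
          (β s * Real.exp (-2 * (Mw β t₀ t - Mw β t₀ s))) := by
      apply intervalIntegral.norm_integral_le_of_norm_le htq _ (hi.const_mul _)
      filter_upwards [ae_ne t₀] with s hne hs
      have hs0 : s < t₀ := lt_of_le_of_ne (hs.2.trans hq) hne
      have hk := h.key hd ht hs.1.le hs0 (hor.imp id (fun hqc => hs.2.trans hqc))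
      have hfs := hfb s ⟨ht.1.trans hs.1, hs0⟩
      rw [norm_mul, norm_expd, div_mul_eq_mul_div, le_div_iff₀ (wp t)]
      calc Real.exp (d.re * (φ t - φ s)) * ‖f s‖ * wt φ β t₀ c L t
          = (Real.exp (d.re * (φ t - φ s)) * wt φ β t₀ c L t) * ‖f s‖ := by ring
        _ ≤ (Real.exp (-2 * (Mw β t₀ t - Mw β t₀ s)) * wt φ β t₀ c L s) * ‖f s‖ :=
            mul_le_mul_of_nonneg_right hk (norm_nonneg _)
        _ = Real.exp (-2 * (Mw β t₀ t - Mw β t₀ s)) * (‖f s‖ * wt φ β t₀ c L s) := by ring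
        _ ≤ Real.exp (-2 * (Mw β t₀ t - Mw β t₀ s)) * (C * β s) :=
            mul_le_mul_of_nonneg_left hfs (Real.exp_pos _).le
        _ = _ := by ring
    rw [intervalIntegral.integral_const_mul] at hb
    calc _ ≤ (C / wt φ β t₀ c L t * ∫ s in t..q,
          (β s * Real.exp (-2 * (Mw β t₀ t - Mw β t₀ s)))) * wt φ β t₀ c L t :=
            mul_le_mul_of_nonneg_right hb (wp t).le
      _ = C * ∫ s in t..q, (β s * Real.exp (-2 * (Mw β t₀ t - Mw β t₀ s))) := by
            field_simp [(wp t).ne']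
      _ ≤ _ := mul_le_mul_of_nonneg_left hle hC
  rw [J_eq]
  unfold base
  split_ifs with hd0
  · rw [intervalIntegral.integral_symm, norm_neg]
    exact back t₀ ht.2.le le_rfl (Or.inl hd0)
  · rcases le_total t c with htc | hct
    · rw [intervalIntegral.integral_symm, norm_neg]
      exact back c htc h.hc.2.le (Or.inr le_rfl)
    · have hi : IntervalIntegrable β volume c t := ii_in h.βc h.hc ht
      have hb : ‖∫ s in c..t, Complex.exp (d * (φ t - φ s : ℝ)) * f s‖ ≤
          ∫ s in c..t, (C * Real.exp (1 / 4) / wt φ β t₀ c L t) * β s := by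
        apply intervalIntegral.norm_integral_le_of_norm_le hct _ (hi.const_mul _)
        refine Eventually.of_forall fun s hs => ?_
        have hs' : s ∈ Ioo a t₀ := ⟨h.hc.1.trans hs.1, hs.2.trans_lt ht.2⟩
        have hfs := hfb s hs'
        have h1 := h.mφ hs' ht hs.2
        have h2 := h.mφ h.hc hs' hs.1.le
        have hk : Real.exp (d.re * (φ t - φ s)) * wt φ β t₀ c L t ≤
            Real.exp (1 / 4) * wt φ β t₀ c L s := by
          unfold wt
          rw [← Real.exp_add, ← Real.exp_add]
          apply Real.exp_le_exp.2
          rw [max_eq_right (by linarith), max_eq_right (by linarith)]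
          have h3 := h.M0 ht.2.le
          have h4 : Mw β t₀ s ≤ 1 / 8 := (h.mM h.hc hs.1.le hs'.2).trans h.βs
          have h5 : d.re * (φ t - φ s) ≤ 0 :=
            mul_nonpos_of_nonpos_of_nonneg (not_le.1 hd0).le (by linarith)
          linarith
        rw [norm_mul, norm_expd, div_mul_eq_mul_div, le_div_iff₀ (wp t)]
        calc Real.exp (d.re * (φ t - φ s)) * ‖f s‖ * wt φ β t₀ c L t
            = (Real.exp (d.re * (φ t - φ s)) * wt φ β t₀ c L t) * ‖f s‖ := by ring
          _ ≤ (Real.exp (1 / 4) * wt φ β t₀ c L s) * ‖f s‖ :=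
              mul_le_mul_of_nonneg_right hk (norm_nonneg _)
          _ = Real.exp (1 / 4) * (‖f s‖ * wt φ β t₀ c L s) := by ring
          _ ≤ Real.exp (1 / 4) * (C * β s) :=
              mul_le_mul_of_nonneg_left hfs (Real.exp_pos _).le
          _ = _ := by ring
      rw [intervalIntegral.integral_const_mul] at hb
      have hle : ∫ s in c..t, β s ≤ 1 / 8 := by
        have := intervalIntegral.integral_add_adjacent_intervals hi (h.βi t ht)
        have h2 := h.M0 ht.2.le
        have h3 := h.βs
        unfold Mw at h2
        linarith
      have he : Real.exp (1 / 4) ≤ 4 := by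
        have : Real.exp (1 / 4) ≤ Real.exp 1 := Real.exp_le_exp.2 (by norm_num)
        linarith [Real.exp_one_lt_d9]
      calc _ ≤ (C * Real.exp (1 / 4) / wt φ β t₀ c L t * ∫ s in c..t, β s) * wt φ β t₀ c L t :=
              mul_le_mul_of_nonneg_right hb (wp t).le
        _ = C * (Real.exp (1 / 4) * ∫ s in c..t, β s) := by
              field_simp [(wp t).ne']
        _ ≤ C * (4 * (1 / 8)) := by
              apply mul_le_mul_of_nonneg_left _ hC
              exact mul_le_mul he hle (intervalIntegral.integral_nonneg hct fun s _ => h.β0 s)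
                (by norm_num)
        _ = _ := by ring

lemma Setup.limJ (h : Setup a t₀ c φ φ' β) (hL : 0 ≤ L) (hC : 0 ≤ C)
    (hf : ContinuousOn f (Ioo a t₀))
    (hfb : ∀ s ∈ Ioo a t₀, ‖f s‖ * wt φ β t₀ c L s ≤ C * β s) :
    Tendsto (J φ t₀ c d f) (𝓝[<] t₀) (𝓝 0) := by
  have hev : ∀ᶠ t in 𝓝[<] t₀, t ∈ Ioo c t₀ := Ioo_mem_nhdsLT h.hc.2
  set K := C / wt φ β t₀ c L c with hK
  have hfK : ∀ s ∈ Ioo c t₀, ‖f s‖ ≤ K * β s := fun s hs => h.f_le hL hC hfb h.hc hs.1.le hs.2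
  by_cases hd0 : 0 ≤ d.re
  · have hlim : Tendsto (fun t => K * Mw β t₀ t) (𝓝[<] t₀) (𝓝 0) := by
      simpa using h.limM.const_mul K
    refine squeeze_zero_norm' ?_ hlim
    filter_upwards [hev] with t ht
    have ht' : t ∈ Ioo a t₀ := ⟨h.hc.1.trans ht.1, ht.2⟩
    rw [J_eq, base, if_pos hd0, intervalIntegral.integral_symm, norm_neg, Mw,
      ← intervalIntegral.integral_const_mul]
    apply intervalIntegral.norm_integral_le_of_norm_le ht.2.le _ ((h.βi t ht').const_mul _)
    filter_upwards [ae_ne t₀] with s hne hs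
    have hs0 : s < t₀ := lt_of_le_of_ne hs.2 hne
    have h1 := h.mφ ht' ⟨ht'.1.trans hs.1, hs0⟩ hs.1.le
    rw [norm_mul, norm_expd]
    refine le_trans (mul_le_of_le_one_left (norm_nonneg _) ?_) (hfK s ⟨ht.1.trans hs.1, hs0⟩)
    rw [Real.exp_le_one_iff]
    exact mul_nonpos_of_nonneg_of_nonpos hd0 (by linarith)
  · have hd1 : d.re < 0 := not_le.1 hd0
    have hDCT : Tendsto (fun t => ∫ s in c..t₀,
        indicator {x | x ≤ t} (fun s => Complex.exp (d * (φ t - φ s : ℝ)) * f s) s)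
        (𝓝[<] t₀) (𝓝 (∫ s in c..t₀, (0 : ℂ))) := by
      apply intervalIntegral.tendsto_integral_filter_of_dominated_convergence (fun s => K * β s)
      · filter_upwards [hev] with t ht
        apply AEStronglyMeasurable.indicator _ measurableSet_Iic
        rw [uIoc_of_le h.hc.2.le, ← restrict_Ioo_eq_restrict_Ioc]
        refine ContinuousOn.aestronglyMeasurable ?_ measurableSet_Ioo
        have h1 := h.cφ.mono (Ioo_subset_Ioo_left h.hc.1.le)
        have h2 := hf.mono (Ioo_subset_Ioo_left h.hc.1.le)
        fun_prop
      · filter_upwards [hev] with t ht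
        filter_upwards [ae_ne t₀] with s hne hs
        rw [uIoc_of_le h.hc.2.le] at hs
        have hs0 : s < t₀ := lt_of_le_of_ne hs.2 hne
        by_cases hst : s ≤ t
        · rw [indicator_of_mem (by exact hst)]
          have h1 := h.mφ ⟨h.hc.1.trans hs.1, hs0⟩ ⟨h.hc.1.trans ht.1, ht.2⟩ hst
          rw [norm_mul, norm_expd]
          refine le_trans (mul_le_of_le_one_left (norm_nonneg _) ?_) (hfK s ⟨hs.1, hs0⟩)
          rw [Real.exp_le_one_iff]
          exact mul_nonpos_of_nonpos_of_nonneg hd1.le (by linarith)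
        · rw [indicator_of_notMem (by exact hst)]
          rw [norm_zero]
          exact (norm_nonneg _).trans (hfK s ⟨hs.1, hs0⟩)
      · exact (h.βi c h.hc).const_mul _
      · refine Eventually.of_forall fun s hs => ?_
        have hl : Tendsto (fun t => Real.exp (d.re * (φ t - φ s)) * ‖f s‖) (𝓝[<] t₀) (𝓝 0) := by
          have h1 : Tendsto (fun t => d.re * (φ t - φ s)) (𝓝[<] t₀) atBot :=
            (tendsto_atTop_add_const_right _ (-φ s) h.hφlim).const_mul_atTop_of_neg hd1
          simpa using (Real.tendsto_exp_atBot.comp h1).mul_const ‖f s‖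
        refine squeeze_zero_norm (fun t => ?_) hl
        refine (norm_indicator_le_norm_self _ _).trans ?_
        rw [norm_mul, norm_expd]
    rw [intervalIntegral.integral_zero] at hDCT
    refine hDCT.congr' ?_
    filter_upwards [hev] with t ht
    rw [intervalIntegral.integral_indicator ⟨ht.1.le, ht.2.le⟩, J_eq, base, if_neg hd0]

end
section
variable {a t₀ c : ℝ} {φ φ' β : ℝ → ℝ} {n : ℕ}

open scoped BoundedContinuousFunction

noncomputable def xf (φ β : ℝ → ℝ) (a t₀ c L : ℝ) (y : Ioo a t₀ →ᵇ (Fin n → ℂ)) (s : ℝ) :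
    Fin n → ℂ :=
  open Classical in
  if h : s ∈ Ioo a t₀ then ((wt φ β t₀ c L s)⁻¹ : ℝ) • y ⟨s, h⟩ else 0

noncomputable def fk (B : ℝ → Matrix (Fin n) (Fin n) ℂ) (x : ℝ → Fin n → ℂ) (k : Fin n) (s : ℝ) :
    ℂ := ∑ l, B s k l * x s l

lemma Setup.cxf (h : Setup a t₀ c φ φ' β) (L : ℝ) (y : Ioo a t₀ →ᵇ (Fin n → ℂ)) :
    ContinuousOn (xf φ β a t₀ c L y) (Ioo a t₀) := by
  rw [continuousOn_iff_continuous_domRestrict]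
  have h1 : Continuous (fun s : Ioo a t₀ => ((wt φ β t₀ c L s)⁻¹ : ℝ) • y s) := by
    have h2 : Continuous (fun s : Ioo a t₀ => wt φ β t₀ c L s) :=
      continuousOn_iff_continuous_domRestrict.1 (h.cw L)
    exact (h2.inv₀ (fun s => wt_pos.ne')).smul y.continuous
  convert h1 using 1
  ext s
  simp [xf]

lemma Setup.cfk (h : Setup a t₀ c φ φ' β) {B : ℝ → Matrix (Fin n) (Fin n) ℂ}
    (hB : ∀ i k, ContinuousOn (fun t => B t i k) (Ioo a t₀)) {x : ℝ → Fin n → ℂ}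
    (hx : ContinuousOn x (Ioo a t₀)) (k : Fin n) : ContinuousOn (fk B x k) (Ioo a t₀) := by
  unfold fk
  refine continuousOn_finsetSum _ fun l _ => (hB k l).mul ?_
  exact (continuous_apply l).comp_continuousOn hx

lemma bfk {B : ℝ → Matrix (Fin n) (Fin n) ℂ} {L : ℝ}
    (hβ : ∀ s k (v : Fin n → ℂ), ‖∑ l, B s k l * v l‖ ≤ β s * ‖v‖)
    (y : Ioo a t₀ →ᵇ (Fin n → ℂ)) (k : Fin n) (h0 : ∀ t, 0 ≤ β t) :
    ∀ s ∈ Ioo a t₀, ‖fk B (xf φ β a t₀ c L y) k s‖ * wt φ β t₀ c L s ≤ ‖y‖ * β s := by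
  intro s hs
  have h1 := hβ s k (xf φ β a t₀ c L y s)
  have wp : 0 < wt φ β t₀ c L s := wt_pos
  have h2 : ‖xf φ β a t₀ c L y s‖ * wt φ β t₀ c L s ≤ ‖y‖ := by
    unfold xf
    rw [dif_pos hs, norm_smul, norm_inv, Real.norm_of_nonneg wp.le]
    have := y.norm_coe_le_norm ⟨s, hs⟩
    field_simp
    exact this
  calc _ ≤ (β s * ‖xf φ β a t₀ c L y s‖) * wt φ β t₀ c L s := mul_le_mul_of_nonneg_right h1 wp.le
    _ = β s * (‖xf φ β a t₀ c L y s‖ * wt φ β t₀ c L s) := by ring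
    _ ≤ β s * ‖y‖ := mul_le_mul_of_nonneg_left h2 (h0 s)
    _ = _ := mul_comm _ _

lemma fk_sub {B : ℝ → Matrix (Fin n) (Fin n) ℂ} {L : ℝ}
    (y z : Ioo a t₀ →ᵇ (Fin n → ℂ)) (k : Fin n) (s : ℝ) :
    fk B (xf φ β a t₀ c L (y - z)) k s =
      fk B (xf φ β a t₀ c L y) k s - fk B (xf φ β a t₀ c L z) k s := by
  unfold fk xf
  rw [← Finset.sum_sub_distrib]
  refine Finset.sum_congr rfl fun l _ => ?_
  split_ifs with hs
  · simp only [BoundedContinuousFunction.coe_sub, Pi.sub_apply, Pi.smul_apply, smul_sub]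
    ring
  · simp

lemma Setup.col (h : Setup a t₀ c φ φ' β) (d : Fin n → ℂ) (j : Fin n) (hj : d j = 0)
    (B : ℝ → Matrix (Fin n) (Fin n) ℂ) (hB : ∀ i k, ContinuousOn (fun t => B t i k) (Ioo a t₀))
    (hβ : ∀ s k (v : Fin n → ℂ), ‖∑ l, B s k l * v l‖ ≤ β s * ‖v‖) :
    ∃ x : ℝ → Fin n → ℂ,
      (∀ t ∈ Ioo a t₀, ∀ k, HasDerivAt (fun t => x t k)
        (φ' t * d k * x t k + ∑ l, B t k l * x t l) t) ∧
      ∀ k, Tendsto (fun t => x t k) (𝓝[<] t₀) (𝓝 (if k = j then 1 else 0)) := by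
  set L := ∑ k, ‖d k‖ with hLdef
  have hL : 0 ≤ L := Finset.sum_nonneg fun k _ => norm_nonneg _
  have hd : ∀ k, ‖d k‖ ≤ L := fun k =>
    Finset.single_le_sum (f := fun k => ‖d k‖) (fun i _ => norm_nonneg _) (Finset.mem_univ k)
  have hcf : ∀ y k, ContinuousOn (fk B (xf φ β a t₀ c L y) k) (Ioo a t₀) :=
    fun y k => h.cfk hB (h.cxf L y) k
  have hbf := fun y k => bfk (φ := φ) (c := c) (L := L) (a := a) (t₀ := t₀) hβ y k h.β0
  let δ : Fin n → ℂ := fun k => if k = j then 1 else 0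
  have hδ : ∀ k, ‖δ k‖ ≤ 1 := by
    intro k; simp only [δ]; split_ifs <;> simp
  let G : (Ioo a t₀ →ᵇ (Fin n → ℂ)) → ℝ → Fin n → ℂ := fun y t k =>
    δ k + J φ t₀ c (d k) (fk B (xf φ β a t₀ c L y) k) t
  have hGc : ∀ y, ContinuousOn (G y) (Ioo a t₀) := by
    intro y
    refine continuousOn_pi.2 fun k => continuousOn_const.add ?_
    exact fun t ht =>
      (h.dJ hL (norm_nonneg y) (hcf y k) (hbf y k) ht).continuousAt.continuousWithinAt
  let T : (Ioo a t₀ →ᵇ (Fin n → ℂ)) → (Ioo a t₀ →ᵇ (Fin n → ℂ)) := fun y =>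
    BoundedContinuousFunction.ofNormedAddCommGroup
      (fun t : Ioo a t₀ => (wt φ β t₀ c L t) • G y t)
      (continuousOn_iff_continuous_domRestrict.1 ((h.cw L).smul (hGc y)))
      (1 + ‖y‖ * (1 / 2)) (by
        intro t
        refine (pi_norm_le_iff_of_nonneg (by positivity)).2 fun k => ?_
        have h1 := h.bJ (hd k) (norm_nonneg y) (hbf y k) t.2
        have h2 := h.wt_le_one hL t.2.2.le
        have wp : 0 < wt φ β t₀ c L t := wt_pos
        rw [Pi.smul_apply, norm_smul, Real.norm_of_nonneg wp.le]
        calc _ ≤ wt φ β t₀ c L t * (‖δ k‖ + ‖J φ t₀ c (d k) (fk B (xf φ β a t₀ c L y) k) t‖) :=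
              mul_le_mul_of_nonneg_left (norm_add_le _ _) wp.le
          _ = wt φ β t₀ c L t * ‖δ k‖ +
              ‖J φ t₀ c (d k) (fk B (xf φ β a t₀ c L y) k) t‖ * wt φ β t₀ c L t := by ring
          _ ≤ 1 * 1 + ‖y‖ * (1 / 2) :=
              add_le_add (mul_le_mul h2 (hδ k) (norm_nonneg _) zero_le_one) h1
          _ = _ := by ring)
  have hT : ∀ y (t : Ioo a t₀) k, T y t k = (wt φ β t₀ c L t) • G y t k := fun y t k => rfl
  have hlip : ContractingWith (1 / 2) T := by
    refine ⟨by
      rw [← NNReal.coe_lt_coe]; norm_num, LipschitzWith.of_dist_le_mul fun y z => ?_⟩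
    rw [dist_eq_norm, dist_eq_norm]
    refine (BoundedContinuousFunction.norm_le (by positivity)).2 fun t => ?_
    refine (pi_norm_le_iff_of_nonneg (by positivity)).2 fun k => ?_
    have h1 := h.bJ (hd k) (norm_nonneg (y - z)) (hbf (y - z) k) t.2
    have wp : 0 < wt φ β t₀ c L t := wt_pos
    have hJ : J φ t₀ c (d k) (fk B (xf φ β a t₀ c L (y - z)) k) t =
        J φ t₀ c (d k) (fk B (xf φ β a t₀ c L y) k) t -
        J φ t₀ c (d k) (fk B (xf φ β a t₀ c L z) k) t := by
      unfold J
      rw [← mul_sub, ← intervalIntegral.integral_sub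
        (h.igf hL (norm_nonneg y) (hcf y k) (hbf y k) t.2)
        (h.igf hL (norm_nonneg z) (hcf z k) (hbf z k) t.2)]
      congr 2
      ext s
      unfold gf
      rw [fk_sub, mul_sub]
    have : (T y - T z) t k = (wt φ β t₀ c L t) •
        J φ t₀ c (d k) (fk B (xf φ β a t₀ c L (y - z)) k) t := by
      rw [BoundedContinuousFunction.sub_apply, Pi.sub_apply, hT, hT, hJ, ← smul_sub]
      simp only [G]
      congr 1
      ring
    rw [this, norm_smul, Real.norm_of_nonneg wp.le, mul_comm]
    refine h1.trans (le_of_eq ?_)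
    push_cast
    ring
  obtain ⟨y, hy⟩ : ∃ y, T y = y := ⟨hlip.fixedPoint, hlip.fixedPoint_isFixedPt⟩
  have hG : ∀ t ∈ Ioo a t₀, xf φ β a t₀ c L y t = G y t := by
    intro t ht
    have wp : 0 < wt φ β t₀ c L t := wt_pos
    ext k
    unfold xf
    rw [dif_pos ht, Pi.smul_apply]
    conv_lhs => rw [← hy]
    rw [hT, smul_smul, inv_mul_cancel₀ wp.ne', one_smul]
  refine ⟨G y, fun t ht k => ?_, fun k => ?_⟩
  · have h1 := (h.dJ (d := d k) hL (norm_nonneg y) (hcf y k) (hbf y k) ht).const_add (δ k)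
    refine h1.congr_deriv ?_
    have h2 : ∑ l, B t k l * G y t l = fk B (xf φ β a t₀ c L y) k t := by
      unfold fk; rw [hG t ht]
    rw [h2]
    have h3 : d k * δ k = 0 := by
      simp only [δ]; split_ifs with hk
      · rw [hk, hj]; simp
      · simp
    simp only [G]
    linear_combination (-(φ' t : ℂ)) * h3
  · have h1 := (h.limJ (d := d k) hL (norm_nonneg y) (hcf y k) (hbf y k)).const_add (δ k)
    rw [add_zero] at h1
    exact h1

lemma fund (hc : c ∈ Ioo a t₀) (hφ : ∀ t ∈ Ioo a t₀, HasDerivAt φ (φ' t) t)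
    (hφ' : ∀ t ∈ Ioo a t₀, 0 ≤ φ' t) (hφlim : Tendsto φ (𝓝[<] t₀) atTop) (lam : Fin n → ℂ)
    (B : ℝ → Matrix (Fin n) (Fin n) ℂ) (hB : ∀ i k, ContinuousOn (fun t => B t i k) (Ioo a t₀))
    (hBi : ∀ i k, IntegrableOn (fun t => B t i k) (Ico c t₀) volume) :
    ∃ X : ℝ → Matrix (Fin n) (Fin n) ℂ,
      (∀ t ∈ Ioo a t₀, ∀ i k, HasDerivAt (fun t => X t i k)
        (φ' t * (lam i - lam k) * X t i k + (B t * X t) i k) t) ∧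
      ∀ i k, Tendsto (fun t => X t i k) (𝓝[<] t₀)
        (𝓝 ((1 : Matrix (Fin n) (Fin n) ℂ) i k)) := by
  let β : ℝ → ℝ := fun s => ∑ k, ∑ l, ‖B s k l‖
  have β0 : ∀ t, 0 ≤ β t := fun t =>
    Finset.sum_nonneg fun k _ => Finset.sum_nonneg fun l _ => norm_nonneg _
  have βc : ContinuousOn β (Ioo a t₀) :=
    continuousOn_finsetSum _ fun k _ => continuousOn_finsetSum _ fun l _ => (hB k l).norm
  have βic : IntervalIntegrable β volume c t₀ := by
    rw [intervalIntegrable_iff_integrableOn_Ico_of_le hc.2.le]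
    exact integrable_finsetSum _ fun k _ => integrable_finsetSum _ fun l _ => (hBi k l).norm
  have βi : ∀ t ∈ Ioo a t₀, IntervalIntegrable β volume t t₀ := fun t ht =>
    (ii_in βc ht hc).trans βic
  have hM : Tendsto (Mw β t₀) (𝓝[<] t₀) (𝓝 0) := by
    have h0 := intervalIntegral.continuousOn_primitive_interval_left (μ := volume) (f := β) (a := c)
      (b := t₀) (by
        rw [uIcc_of_le hc.2.le]
        exact (intervalIntegrable_iff_integrableOn_Icc_of_le hc.2.le).1 βic)
    rw [uIcc_of_le hc.2.le] at h0
    have h1 : ContinuousWithinAt (Mw β t₀) (Icc c t₀) t₀ := h0 t₀ ⟨hc.2.le, le_rfl⟩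
    rw [ContinuousWithinAt, M_t0] at h1
    refine h1.mono_left ?_
    rw [← nhdsWithin_Ico_eq_nhdsLT hc.2]
    exact nhdsWithin_mono _ Ico_subset_Icc_self
  obtain ⟨c', hc1, hc2⟩ := ((hM.eventually (gt_mem_nhds (show (0 : ℝ) < 1 / 8 by norm_num))).and
    (Ioo_mem_nhdsLT hc.2)).exists
  have hS : Setup a t₀ c' φ φ' β :=
    ⟨⟨hc.1.trans hc2.1, hc2.2⟩, hφ, hφ', hφlim, β0, βc, βi, hc1.le⟩
  have hβ : ∀ s k (v : Fin n → ℂ), ‖∑ l, B s k l * v l‖ ≤ β s * ‖v‖ := by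
    intro s k v
    calc _ ≤ ∑ l, ‖B s k l * v l‖ := norm_sum_le _ _
      _ ≤ ∑ l, ‖B s k l‖ * ‖v‖ := Finset.sum_le_sum fun l _ => by
          rw [norm_mul]; exact mul_le_mul_of_nonneg_left (norm_le_pi_norm v l) (norm_nonneg _)
      _ = (∑ l, ‖B s k l‖) * ‖v‖ := by rw [Finset.sum_mul]
      _ ≤ _ := mul_le_mul_of_nonneg_right (Finset.single_le_sum (f := fun k => ∑ l, ‖B s k l‖)
          (fun i _ => Finset.sum_nonneg fun l _ => norm_nonneg _) (Finset.mem_univ k))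
          (norm_nonneg _)
  have := fun j => hS.col (fun k => lam k - lam j) j (sub_self _) B hB hβ
  choose x hx1 hx2 using this
  refine ⟨fun t i k => x k t i, fun t ht i k => ?_, fun i k => ?_⟩
  · exact hx1 k t ht i
  · rw [Matrix.one_apply]; exact hx2 k i

end
section
variable {n : ℕ}

lemma phi_exists (t₀ : ℝ) (μ : ℕ) (αμ : ℝ) (hαμ : αμ = if μ = 0 then 1 else (μ : ℝ))
    (lam : Fin n → ℂ) :
    ∃ φ : ℝ → ℝ, (∀ t < t₀, HasDerivAt φ (αμ / (t₀ - t) ^ (μ + 1)) t) ∧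
      Tendsto φ (𝓝[<] t₀) atTop ∧
      ∀ R P, ∀ t < t₀, uSolSing n t₀ μ lam R P t =
        ∑ j, Complex.exp (lam j * φ t) • ((1 + R t) * P j) := by
  have hlim : Tendsto (fun t => t₀ - t) (𝓝[<] t₀) (𝓝[>] 0) := by
    refine tendsto_nhdsWithin_iff.2 ⟨?_, ?_⟩
    · have : Tendsto (fun t => t₀ - t) (𝓝 t₀) (𝓝 (t₀ - t₀)) := by
        apply Continuous.tendsto; fun_prop
      rw [sub_self] at this
      exact this.mono_left nhdsWithin_le_nhds
    · filter_upwards [self_mem_nhdsWithin] with t ht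
      exact sub_pos.2 (mem_Iio.1 ht)
  have hsub : ∀ t, HasDerivAt (fun t => t₀ - t) (-1) t := fun t => by
    simpa using (hasDerivAt_id t).const_sub t₀
  by_cases hμ : μ = 0
  · subst hμ
    simp only [if_true] at hαμ
    subst hαμ
    refine ⟨fun t => -Real.log (t₀ - t), fun t ht => ?_, ?_, fun R P t ht => ?_⟩
    · have h0 : t₀ - t ≠ 0 := (sub_pos.2 ht).ne'
      refine ((hsub t).log h0).neg.congr_deriv ?_
      field_simp
      ring
    · exact tendsto_neg_atBot_atTop.comp (Real.tendsto_log_nhdsGT_zero.comp hlim)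
    · have h0 : 0 < t₀ - t := sub_pos.2 ht
      unfold uSolSing
      rw [if_pos rfl]
      refine Finset.sum_congr rfl fun j _ => ?_
      congr 1
      rw [Complex.cpow_def_of_ne_zero (by exact_mod_cast h0.ne'), ← Complex.ofReal_log h0.le]
      congr 1
      push_cast; ring
  · rw [if_neg hμ] at hαμ
    subst hαμ
    refine ⟨fun t => ((t₀ - t) ^ μ)⁻¹, fun t ht => ?_, ?_, fun R P t ht => ?_⟩
    · have h0 : t₀ - t ≠ 0 := (sub_pos.2 ht).ne'
      refine (((hsub t).fun_pow μ).fun_inv (pow_ne_zero _ h0)).congr_deriv ?_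
      obtain ⟨m, rfl⟩ := Nat.exists_eq_succ_of_ne_zero hμ
      simp only [Nat.succ_eq_add_one, Nat.add_sub_cancel]
      field_simp
      ring
    · have h1 : Tendsto (fun t => (t₀ - t) ^ μ) (𝓝[<] t₀) (𝓝[>] 0) := by
        refine tendsto_nhdsWithin_iff.2 ⟨?_, ?_⟩
        · have := (hlim.mono_right nhdsWithin_le_nhds).pow μ
          rwa [zero_pow hμ] at this
        · filter_upwards [self_mem_nhdsWithin] with t ht
          exact pow_pos (sub_pos.2 (mem_Iio.1 ht)) μ
      exact tendsto_inv_nhdsGT_zero.comp h1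
    · unfold uSolSing
      rw [if_neg hμ]
      refine Finset.sum_congr rfl fun j _ => ?_
      congr 3
      push_cast; rfl

lemma isUnit_back {a t₀ t t₁ : ℝ} {G u : ℝ → Matrix (Fin n) (Fin n) ℂ}
    (hG : ∀ i k, ContinuousOn (fun t => G t i k) (Ioo a t₀))
    (hu : ∀ t ∈ Ioo a t₀, ∀ i k, HasDerivAt (fun t => u t i k) ((G t * u t) i k) t)
    (ht : a < t) (htt : t ≤ t₁) (ht₁ : t₁ < t₀) (h : IsUnit (u t₁)) : IsUnit (u t) := by
  have hsub : Icc t t₁ ⊆ Ioo a t₀ := fun s hs => ⟨ht.trans_le hs.1, hs.2.trans_lt ht₁⟩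
  rw [Matrix.isUnit_iff_isUnit_det, isUnit_iff_ne_zero] at h ⊢
  intro h0
  obtain ⟨v, hv, hv0⟩ := Matrix.exists_mulVec_eq_zero_iff.2 h0
  let β : ℝ → ℝ := fun s => ∑ k, ∑ l, ‖G s k l‖
  have βc : ContinuousOn β (Ioo a t₀) :=
    continuousOn_finsetSum _ fun k _ => continuousOn_finsetSum _ fun l _ => (hG k l).norm
  obtain ⟨K, hK⟩ := isCompact_Icc.bddAbove_image (βc.mono hsub)
  have hK' : ∀ s ∈ Icc t t₁, β s ≤ K := fun s hs => hK ⟨s, hs, rfl⟩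
  have β0 : ∀ t, 0 ≤ β t := fun t =>
    Finset.sum_nonneg fun k _ => Finset.sum_nonneg fun l _ => norm_nonneg _
  have hβ : ∀ s (v : Fin n → ℂ), ‖(G s).mulVec v‖ ≤ β s * ‖v‖ := by
    intro s v
    refine (pi_norm_le_iff_of_nonneg (mul_nonneg (β0 s) (norm_nonneg _))).2 fun k => ?_
    calc _ ≤ ∑ l, ‖G s k l * v l‖ := norm_sum_le _ _
      _ ≤ ∑ l, ‖G s k l‖ * ‖v‖ := Finset.sum_le_sum fun l _ => by
          rw [norm_mul]; exact mul_le_mul_of_nonneg_left (norm_le_pi_norm v l) (norm_nonneg _)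
      _ = (∑ l, ‖G s k l‖) * ‖v‖ := by rw [Finset.sum_mul]
      _ ≤ _ := mul_le_mul_of_nonneg_right (Finset.single_le_sum (f := fun k => ∑ l, ‖G s k l‖)
          (fun i _ => Finset.sum_nonneg fun l _ => norm_nonneg _) (Finset.mem_univ k))
          (norm_nonneg _)
  have hz : ∀ s ∈ Ioo a t₀, HasDerivAt (fun s => (u s).mulVec v)
      ((G s).mulVec ((u s).mulVec v)) s := by
    intro s hs
    refine hasDerivAt_pi.2 fun i => ?_
    rw [Matrix.mulVec_mulVec]
    simp only [Matrix.mulVec, dotProduct]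
    exact HasDerivAt.fun_sum fun l _ => (hu s hs i l).mul_const _
  have hK0 : 0 ≤ K := (β0 t).trans (hK' t ⟨le_rfl, htt⟩)
  have := ODE_solution_unique_of_mem_Icc_right (K := K.toNNReal) (a := t) (b := t₁)
    (v := fun s x => (G s).mulVec x) (s := fun _ => univ)
    (f := fun s => (u s).mulVec v) (g := fun _ => 0)
    (fun s hs => LipschitzOnWith.of_dist_le_mul fun x _ y _ => by
      rw [dist_eq_norm, dist_eq_norm, ← Matrix.mulVec_sub, Real.coe_toNNReal _ hK0]
      exact (hβ s _).trans
        (mul_le_mul_of_nonneg_right (hK' s (Ico_subset_Icc_self hs)) (norm_nonneg _)))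
    (fun s hs => (hz s (hsub hs)).continuousAt.continuousWithinAt)
    (fun s hs => (hz s (hsub (Ico_subset_Icc_self hs))).hasDerivWithinAt)
    (fun _ _ => mem_univ _) continuousOn_const
    (fun s _ => by
      simp only [Matrix.mulVec_zero]
      exact (hasDerivAt_const s (0 : Fin n → ℂ)).hasDerivWithinAt)
    (fun _ _ => mem_univ _) hv0
  exact h (Matrix.exists_mulVec_eq_zero_iff.1 ⟨v, hv, this ⟨htt, le_rfl⟩⟩)

lemma hd_conj (S T : Matrix (Fin n) (Fin n) ℂ) {Y : ℝ → Matrix (Fin n) (Fin n) ℂ}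
    {Y' : Matrix (Fin n) (Fin n) ℂ} {t : ℝ}
    (h : ∀ i k, HasDerivAt (fun t => Y t i k) (Y' i k) t) (i k : Fin n) :
    HasDerivAt (fun t => (S * Y t * T) i k) ((S * Y' * T) i k) t := by
  simp only [Matrix.mul_apply]
  exact HasDerivAt.fun_sum fun l _ =>
    (HasDerivAt.fun_sum fun m _ => (h m l).const_mul _).mul_const _

end

end Lev

theorem stmt_14 (n : ℕ) (hn : 1 ≤ n) (a t₀ : ℝ) (hat₀ : a < t₀) (μ : ℕ)
    (αμ : ℝ) (hαμ : αμ = if μ = 0 then 1 else (μ : ℝ))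
    (A₀ : Matrix (Fin n) (Fin n) ℂ) (e' : Fin n → (Fin n → ℂ)) (lam : Fin n → ℂ)
    (P : Fin n → Matrix (Fin n) (Fin n) ℂ)
    (hindep : LinearIndependent ℂ e')
    (hspan : Submodule.span ℂ (Set.range e') = ⊤)
    (heig : ∀ j, A₀.mulVec (e' j) = lam j • e' j)
    (hP : ∀ j k, (P j).mulVec (e' k) = if j = k then e' j else 0)
    (A₁ : ℝ → Matrix (Fin n) (Fin n) ℂ)
    (hA₁cont : ∀ j k, ContinuousOn (fun t => A₁ t j k) (Set.Ioo a t₀))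
    (c : ℝ) (hc : c ∈ Set.Ioo a t₀)
    (hA₁int : ∀ j k, IntegrableOn (fun t => A₁ t j k) (Set.Ico c t₀) volume) :
    ∃ R : ℝ → Matrix (Fin n) (Fin n) ℂ,
      (∀ j k, ContDiffOn ℝ 1 (fun t => R t j k) (Set.Ioo a t₀)) ∧
      (∀ j k, Tendsto (fun t => R t j k) (nhdsWithin t₀ (Set.Iio t₀)) (nhds 0)) ∧
      ∀ t ∈ Set.Ioo a t₀,
        IsUnit (uSolSing n t₀ μ lam R P t) ∧
        ∀ i k, HasDerivAt (fun s => uSolSing n t₀ μ lam R P s i k)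
          ((((αμ / (t₀ - t) ^ (μ + 1) : ℝ) • A₀ + A₁ t) * uSolSing n t₀ μ lam R P t) i k) t := by
  obtain ⟨φ, hφ, hφlim, hu⟩ := Lev.phi_exists (n := n) t₀ μ αμ hαμ lam
  have hα0 : 0 ≤ αμ := by rw [hαμ]; split_ifs <;> positivity
  let φ' : ℝ → ℝ := fun t => αμ / (t₀ - t) ^ (μ + 1)
  have hφ'c : ContinuousOn φ' (Set.Ioo a t₀) := by
    refine continuousOn_const.div (by fun_prop) fun t ht => ?_
    exact pow_ne_zero _ (sub_pos.2 ht.2).ne'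
  let S : Matrix (Fin n) (Fin n) ℂ := Matrix.of fun i j => e' j i
  have hS : IsUnit S := by
    rw [← Matrix.linearIndependent_cols_iff_isUnit]
    exact hindep
  have hSd : IsUnit S.det := (Matrix.isUnit_iff_isUnit_det S).1 hS
  have hS1 : S * S⁻¹ = 1 := Matrix.mul_nonsing_inv S hSd
  have hS2 : S⁻¹ * S = 1 := Matrix.nonsing_inv_mul S hSd
  have hA₀ : A₀ * S = S * Matrix.diagonal lam := by
    ext i k
    rw [Matrix.mul_diagonal]
    have := congrFun (heig k) i
    simp only [Matrix.mulVec, dotProduct, Pi.smul_apply, smul_eq_mul] at this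
    rw [Matrix.mul_apply]
    simp only [S, Matrix.of_apply]
    rw [this, mul_comm]
  have hPj : ∀ j, P j = S * Matrix.diagonal (Pi.single j 1) * S⁻¹ := by
    intro j
    have h1 : P j * S = S * Matrix.diagonal (Pi.single j 1) := by
      ext i k
      rw [Matrix.mul_diagonal]
      have := congrFun (hP j k) i
      simp only [Matrix.mulVec, dotProduct] at this
      rw [Matrix.mul_apply]
      simp only [S, Matrix.of_apply]
      rw [this]
      by_cases hjk : j = k
      · subst hjk; simp
      · simp [hjk]
    rw [← h1, Matrix.mul_assoc, hS1, Matrix.mul_one]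
  let B : ℝ → Matrix (Fin n) (Fin n) ℂ := fun t => S⁻¹ * A₁ t * S
  have hBc : ∀ i k, ContinuousOn (fun t => B t i k) (Set.Ioo a t₀) := by
    intro i k
    simp only [B, Matrix.mul_apply]
    exact continuousOn_finsetSum _ fun l _ => (continuousOn_finsetSum _ fun m _ =>
      continuousOn_const.mul (hA₁cont m l)).mul continuousOn_const
  have hBi : ∀ i k, IntegrableOn (fun t => B t i k) (Set.Ico c t₀) volume := by
    intro i k
    simp only [B, Matrix.mul_apply]
    exact integrable_finsetSum _ fun l _ => (integrable_finsetSum _ fun m _ =>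
      (hA₁int m l).const_mul _).mul_const _
  obtain ⟨X, hX, hXlim⟩ := Lev.fund (φ := φ) (φ' := φ') hc (fun t ht => hφ t ht.2)
    (fun t ht => div_nonneg hα0 (pow_nonneg (sub_pos.2 ht.2).le _)) hφlim lam B hBc hBi
  let Λ : ℝ → Matrix (Fin n) (Fin n) ℂ := fun t =>
    Matrix.diagonal fun j => Complex.exp (lam j * φ t)
  let R : ℝ → Matrix (Fin n) (Fin n) ℂ := fun t => S * X t * S⁻¹ - 1
  have hRu : ∀ t < t₀, uSolSing n t₀ μ lam R P t = S * (X t * Λ t) * S⁻¹ := by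
    intro t ht
    rw [hu R P t ht]
    have h1 : ∀ j, Complex.exp (lam j * φ t) • ((1 + R t) * P j) =
        S * X t * (Complex.exp (lam j * φ t) • Matrix.diagonal (Pi.single j 1)) * S⁻¹ := by
      intro j
      rw [hPj]
      simp only [R, add_sub_cancel, Matrix.mul_smul, Matrix.smul_mul]
      congr 1
      calc S * X t * S⁻¹ * (S * Matrix.diagonal (Pi.single j 1) * S⁻¹)
          = S * X t * (S⁻¹ * S) * Matrix.diagonal (Pi.single j 1) * S⁻¹ := by noncomm_ring
        _ = _ := by rw [hS2, Matrix.mul_one]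
    rw [Finset.sum_congr rfl fun j _ => h1 j, ← Matrix.sum_mul, ← Matrix.mul_sum]
    have h2 : ∑ j, Complex.exp (lam j * φ t) •
        (Matrix.diagonal (Pi.single j 1) : Matrix (Fin n) (Fin n) ℂ) = Λ t := by
      ext i k
      rw [Matrix.sum_apply]
      simp only [Matrix.smul_apply, Matrix.diagonal_apply, Λ, smul_eq_mul]
      by_cases hik : i = k
      · subst hik
        simp [Pi.single_apply]
      · simp [hik]
    rw [h2]
    simp only [Matrix.mul_assoc]
  have hXc : ∀ i k, ContinuousOn (fun t => X t i k) (Set.Ioo a t₀) := fun i k t ht =>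
    (hX t ht i k).continuousAt.continuousWithinAt
  have hXC1 : ∀ i k, ContDiffOn ℝ 1 (fun t => X t i k) (Set.Ioo a t₀) := by
    intro i k
    rw [show (1 : WithTop ℕ∞) = 0 + 1 from (zero_add 1).symm,
      contDiffOn_succ_iff_deriv_of_isOpen isOpen_Ioo, contDiffOn_zero]
    refine ⟨fun t ht => (hX t ht i k).differentiableAt.differentiableWithinAt,
      fun h => absurd h (by simp), ?_⟩
    have : ContinuousOn (fun t => φ' t * (lam i - lam k) * X t i k + (B t * X t) i k)
        (Set.Ioo a t₀) := by
      refine ContinuousOn.add (ContinuousOn.mul (ContinuousOn.mul ?_ continuousOn_const)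
        (hXc i k)) ?_
      · exact Complex.continuous_ofReal.comp_continuousOn hφ'c
      · simp only [Matrix.mul_apply]
        exact continuousOn_finsetSum _ fun l _ => (hBc i l).mul (hXc l k)
    exact this.congr fun t ht => (hX t ht i k).deriv
  have hY : ∀ t ∈ Set.Ioo a t₀, ∀ i k, HasDerivAt (fun t => (X t * Λ t) i k)
      ((((φ' t : ℂ) • Matrix.diagonal lam + B t) * (X t * Λ t)) i k) t := by
    intro t ht i k
    have h1 : (fun t => (X t * Λ t) i k) = fun t => X t i k * Complex.exp (lam k * φ t) := by
      ext s; simp only [Λ, Matrix.mul_diagonal]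
    have h2 := (((hφ t ht.2).ofReal_comp).const_mul (lam k)).cexp
    rw [h1]
    refine ((hX t ht i k).mul h2).congr_deriv ?_
    rw [← Matrix.mul_assoc, Matrix.mul_diagonal, Matrix.add_mul, Matrix.add_apply,
      Matrix.smul_mul, Matrix.smul_apply, Matrix.diagonal_mul, smul_eq_mul]
    simp only [φ']
    ring
  have hder : ∀ t ∈ Set.Ioo a t₀, ∀ i k, HasDerivAt (fun s => uSolSing n t₀ μ lam R P s i k)
      ((((αμ / (t₀ - t) ^ (μ + 1) : ℝ) • A₀ + A₁ t) * uSolSing n t₀ μ lam R P t) i k) t := by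
    intro t ht i k
    have h1 := Lev.hd_conj S S⁻¹ (hY t ht) i k
    have h2 : (fun s => uSolSing n t₀ μ lam R P s i k) =ᶠ[nhds t]
        fun s => (S * (X s * Λ s) * S⁻¹) i k := by
      filter_upwards [Iio_mem_nhds ht.2] with s hs
      rw [hRu s hs]
    refine (h1.congr_of_eventuallyEq h2).congr_deriv ?_
    rw [hRu t ht.2]
    have h3 : ((αμ / (t₀ - t) ^ (μ + 1) : ℝ) • A₀ + A₁ t) * S =
        S * ((φ' t : ℂ) • Matrix.diagonal lam + B t) := by
      have h4 : S * B t = A₁ t * S := by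
        simp only [B]
        rw [← Matrix.mul_assoc, ← Matrix.mul_assoc, hS1, Matrix.one_mul]
      have h5 : (αμ / (t₀ - t) ^ (μ + 1) : ℝ) • A₀ = (φ' t : ℂ) • A₀ := by
        ext p q
        simp only [Matrix.smul_apply, φ', smul_eq_mul, Complex.real_smul]
      rw [h5, Matrix.add_mul, Matrix.mul_add, h4, Matrix.smul_mul, Matrix.mul_smul, hA₀]
    rw [← Matrix.mul_assoc S, ← h3]
    simp only [Matrix.mul_assoc]
  refine ⟨R, fun i k => ?_, fun i k => ?_, fun t ht => ⟨?_, hder t ht⟩⟩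
  · simp only [R, Matrix.sub_apply, Matrix.mul_apply]
    refine ContDiffOn.sub (ContDiffOn.sum fun l _ => ContDiffOn.mul (ContDiffOn.sum fun m _ =>
      contDiffOn_const.mul (hXC1 m l)) contDiffOn_const) contDiffOn_const
  · have h1 : Tendsto (fun t => (S * X t * S⁻¹ - 1) i k) (nhdsWithin t₀ (Set.Iio t₀))
        (nhds ((S * 1 * S⁻¹ - 1 : Matrix (Fin n) (Fin n) ℂ) i k)) := by
      simp only [Matrix.sub_apply]
      refine Tendsto.sub_const ?_ _
      simp only [Matrix.mul_apply]
      exact tendsto_finsetSum _ fun l _ => (tendsto_finsetSum _ fun m _ =>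
        (hXlim m l).const_mul _).mul_const _
    rwa [Matrix.mul_one, hS1, sub_self, Matrix.zero_apply] at h1
  · have hdet : Tendsto (fun t => (X t).det) (nhdsWithin t₀ (Set.Iio t₀)) (nhds 1) := by
      have hXt : Tendsto X (nhdsWithin t₀ (Set.Iio t₀)) (nhds 1) :=
        tendsto_pi_nhds.2 fun i => tendsto_pi_nhds.2 fun k => hXlim i k
      have := ((continuous_id.matrix_det (n := Fin n) (R := ℂ)).tendsto 1).comp hXt
      rw [id, Matrix.det_one] at this
      exact this
    obtain ⟨t₁, hne, ht₁⟩ := ((hdet.eventually_ne one_ne_zero).and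
      (Ioo_mem_nhdsLT ht.2)).exists
    refine Lev.isUnit_back
      (G := fun t => (αμ / (t₀ - t) ^ (μ + 1) : ℝ) • A₀ + A₁ t) ?_ hder ht.1 ht₁.1.le ht₁.2 ?_
    · intro i k
      simp only [Matrix.add_apply, Matrix.smul_apply]
      exact (hφ'c.smul continuousOn_const).add (hA₁cont i k)
    · rw [hRu t₁ ht₁.2, Matrix.isUnit_iff_isUnit_det, Matrix.det_mul, Matrix.det_mul,
        Matrix.det_mul, isUnit_iff_ne_zero]
      refine mul_ne_zero (mul_ne_zero hSd.ne_zero (mul_ne_zero hne ?_)) ?_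
      · simp only [Λ, Matrix.det_diagonal]
        exact Finset.prod_ne_zero_iff.2 fun j _ => Complex.exp_ne_zero _
      · exact (Matrix.isUnit_nonsing_inv_det S hSd).ne_zero
end
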